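/- Let φ be a Sturmian coloring of a d-regular tree. (1) If D is a class of n-balls distinct from A_n, B_n, C_n and S_n, and D is adjacent to S_n in the graph G_n, then D is a vertex of degree 1 in G_n and G_{n+1} contains a cycle. (2) If a ball of class B_{n+1} can be adjacent to a ball of class A_n (respectively, a ball of class A_{n+1} can be adjacent to a ball of class B_n) and A_n ≠ S_n, C_n (resp. B_n ≠ S_n, C_n), then G_{n+1} contains a cycle. -/

import Mathlib

open scoped Classical

noncomputable section

namespace Sturm

variable {V α : Type}

/-- `G` is a `d`-regular tree. -/
structure IsRegularTree (G : SimpleGraph V) (d : ℕ) : Prop where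
  isTree : G.IsTree
  regular : ∀ v : V, (G.neighborSet v).ncard = d

/-- Color-preserving isomorphism of the `n`-balls centered at `x` and `y`,
sending center to center. -/
def BallEquiv (G : SimpleGraph V) (φ : V → α) (n : ℕ) (x y : V) : Prop :=
  ∃ f : {z : V // G.dist x z ≤ n} ≃ {z : V // G.dist y z ≤ n},
    (∀ u v : {z : V // G.dist x z ≤ n}, G.Adj u.1 v.1 ↔ G.Adj (f u).1 (f v).1) ∧
    (∀ u : {z : V // G.dist x z ≤ n}, φ (f u).1 = φ u.1) ∧
    ((f ⟨x, by rw [SimpleGraph.dist_self]; exact Nat.zero_le n⟩).1 = y)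

/-- The class of the `n`-ball at `x`, viewed as the set of all centers of equivalent balls. -/
def ballClass (G : SimpleGraph V) (φ : V → α) (n : ℕ) (x : V) : Set V :=
  {y | BallEquiv G φ n x y}

/-- The set `B_n(φ)` of classes of `n`-balls occurring in `(T, φ)`. -/
def ballClasses (G : SimpleGraph V) (φ : V → α) (n : ℕ) : Set (Set V) :=
  {C | ∃ x, C = ballClass G φ n x}

/-- A coloring is Sturmian if its factor complexity is `n + 2`. -/
def IsSturmian (G : SimpleGraph V) (φ : V → α) : Prop :=
  ∀ n, (ballClasses G φ n).ncard = n + 2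

/-- `x` is the center of a special `n`-ball. -/
def IsSpecialVert (G : SimpleGraph V) (φ : V → α) (n : ℕ) (x : V) : Prop :=
  ∃ y, BallEquiv G φ n x y ∧ ¬ BallEquiv G φ (n + 1) x y

/-- `S` is a special class of `n`-balls: the restriction of two distinct classes of
`(n+1)`-balls. -/
def IsSpecialClass (G : SimpleGraph V) (φ : V → α) (n : ℕ) (S : Set V) : Prop :=
  ∃ x, S = ballClass G φ n x ∧ IsSpecialVert G φ n x

/-- The class `D` is always adjacent to the class `E`. -/
def AlwaysAdjTo (G : SimpleGraph V) (D E : Set V) : Prop :=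
  ∀ x ∈ D, ∃ y, G.Adj x y ∧ y ∈ E

/-- The classes `D` and `E` are (always) adjacent. -/
def AlwaysAdj (G : SimpleGraph V) (D E : Set V) : Prop :=
  AlwaysAdjTo G D E ∧ AlwaysAdjTo G E D

/-- The classes `D` and `E` can be adjacent. -/
def CanAdj (G : SimpleGraph V) (D E : Set V) : Prop :=
  ∃ x ∈ D, ∃ y ∈ E, G.Adj x y

/-- The number of neighbors of `x` lying in (i.e. being centers of balls of class) `E`. -/
def nbrCount (G : SimpleGraph V) (x : V) (E : Set V) : ℕ :=
  (G.neighborSet x ∩ E).ncard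

/-- The data of the labels `S_n, C_n, A_n, B_n` for a Sturmian coloring, normalized as in
the paper: `S_0 = A_0 = [a]`, `B_0 = [b]`, `A_{n+1}` (resp. `B_{n+1}`) is always adjacent
to `A_n` (resp. `B_n`), and `A_{n+1}, B_{n+1}` are the two distinct extensions of `S_n`. -/
structure Labeling (G : SimpleGraph V) (φ : V → α) (a b : α) where
  S : ℕ → Set V
  C : ℕ → Set V
  A : ℕ → Set V
  B : ℕ → Set V
  S_special : ∀ n, IsSpecialClass G φ n (S n)
  C_central : ∀ n, ∃ x, IsSpecialVert G φ (n + 1) x ∧ S (n + 1) = ballClass G φ (n + 1) x ∧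
      C n = ballClass G φ n x
  A0_eq_S0 : A 0 = S 0
  A0_col : ∃ x, φ x = a ∧ A 0 = ballClass G φ 0 x
  B0_col : ∃ x, φ x = b ∧ B 0 = ballClass G φ 0 x
  A_ext : ∀ n, ∃ x, IsSpecialVert G φ n x ∧ S n = ballClass G φ n x ∧
      A (n + 1) = ballClass G φ (n + 1) x
  B_ext : ∀ n, ∃ x, IsSpecialVert G φ n x ∧ S n = ballClass G φ n x ∧
      B (n + 1) = ballClass G φ (n + 1) x
  AB_ne : ∀ n, A (n + 1) ≠ B (n + 1)
  A_adj : ∀ n, AlwaysAdjTo G (A (n + 1)) (A n)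
  B_adj : ∀ n, AlwaysAdjTo G (B (n + 1)) (B n)

/-- A cycle (of length `≥ 3`, with pairwise distinct vertices) in the graph `G_n` of
classes of `n`-balls, where classes are joined when they can be adjacent. -/
def IsCycleIn (G : SimpleGraph V) (φ : V → α) (n k : ℕ) (c : ℕ → Set V) : Prop :=
  3 ≤ k ∧ (∀ i < k, c i ∈ ballClasses G φ n) ∧
    (∀ i < k, CanAdj G (c i) (c ((i + 1) % k))) ∧
    (∀ i < k, ∀ j < k, c i = c j → i = j)

/-- The graph `G_n` contains a cycle. -/
def HasCycle (G : SimpleGraph V) (φ : V → α) (n : ℕ) : Prop :=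
  ∃ k c, IsCycleIn G φ n k c

/-! ## Edge-indexed colored graphs -/

/-- An edge-indexed graph, with vertices colored by `α` and labeled by classes
(sets of vertices of the underlying tree `V`). Index `0` means "no edge". -/
structure EIG (V α : Type) where
  Vert : Type
  idx : Vert → Vert → ℕ
  col : Vert → α
  lab : Vert → Set V

/-- Isomorphism of colored edge-indexed graphs. -/
structure EIGIso (X Y : EIG V α) where
  e : X.Vert ≃ Y.Vert
  idx_eq : ∀ u v, Y.idx (e u) (e v) = X.idx u v
  col_eq : ∀ u, Y.col (e u) = X.col u

/-- The index `i_A(D, E)` (resp. `i_B`, `i`) at the level of classes: the number of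
neighbors, in class `E`, of a representative center of `D`; when `D` is the special
class `Sp`, the representative is taken with extension of class `Ext`. -/
def classIdx (G : SimpleGraph V) (Sp Ext : Set V) (D E : Set V) : ℕ :=
  if D = Sp then (if h : Ext.Nonempty then nbrCount G h.some E else 0)
  else (if h : D.Nonempty then nbrCount G h.some E else 0)

/-- The classes of `n`-balls joined to `Sp` by a path of edges of positive `J`-index. -/
def reachSet (G : SimpleGraph V) (φ : V → α) (n : ℕ) (Sp : Set V)
    (J : Set V → Set V → ℕ) : Set (Set V) :=
  {D | ∃ k, ∃ c : ℕ → Set V, c 0 = Sp ∧ c k = D ∧ (∀ i ≤ k, c i ∈ ballClasses G φ n) ∧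
    ∀ i < k, 0 < J (c i) (c (i + 1)) ∨ 0 < J (c (i + 1)) (c i)}

/-- Color of a class: the color of (the center of) any of its representatives. -/
def colOf [Nonempty V] (φ : V → α) (D : Set V) : α :=
  if h : D.Nonempty then φ h.some else φ (Classical.arbitrary V)

/-- The edge-indexed graph `G^A_n` (when `Ext = A_{n+1}`) resp. `G^B_n`. -/
def sideEIG [Nonempty V] (G : SimpleGraph V) (φ : V → α) (n : ℕ) (Sp Ext : Set V) :
    EIG V α where
  Vert := {D : Set V // D ∈ reachSet G φ n Sp (classIdx G Sp Ext)}
  idx := fun D E => classIdx G Sp Ext D.1 E.1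
  col := fun D => colOf φ D.1
  lab := fun D => D.1

variable {G : SimpleGraph V} {φ : V → α} {a b : α}

/-- The edge-indexed graph `G^A_n`. -/
def GAeig [Nonempty V] (L : Labeling G φ a b) (n : ℕ) : EIG V α :=
  sideEIG G φ n (L.S n) (L.A (n + 1))

/-- The edge-indexed graph `G^B_n`. -/
def GBeig [Nonempty V] (L : Labeling G φ a b) (n : ℕ) : EIG V α :=
  sideEIG G φ n (L.S n) (L.B (n + 1))

/-- Vertex set of `G^A_n`. -/
def VGAset (L : Labeling G φ a b) (n : ℕ) : Set (Set V) :=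
  reachSet G φ n (L.S n) (classIdx G (L.S n) (L.A (n + 1)))

/-- Vertex set of `G^B_n`. -/
def VGBset (L : Labeling G φ a b) (n : ℕ) : Set (Set V) :=
  reachSet G φ n (L.S n) (classIdx G (L.S n) (L.B (n + 1)))

/-- `G^A_n` or `G^B_n`, selected by a letter (`true = A`, `false = B`). -/
def GsideEIG [Nonempty V] (L : Labeling G φ a b) (n : ℕ) : Bool → EIG V α
  | true => GAeig L n
  | false => GBeig L n

/-- Vertex set of `G^A_n` or `G^B_n`, selected by a letter. -/
def VGside (L : Labeling G φ a b) (n : ℕ) : Bool → Set (Set V)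
  | true => VGAset L n
  | false => VGBset L n

/-- A single vertex with a loop of index `d` (the graph `G^A_{-1} = G^B_{-1} = F^._{-1}`). -/
def baseEIG (V : Type) (x : α) (d : ℕ) : EIG V α where
  Vert := PUnit
  idx := fun _ _ => d
  col := fun _ => x
  lab := fun _ => Set.univ

/-- `GAx L d (n+1) = G^A_n`, and `GAx L d 0 = G^A_{-1}`. -/
def GAx [Nonempty V] (L : Labeling G φ a b) (d : ℕ) : ℕ → EIG V α
  | 0 => baseEIG V a d
  | n + 1 => GAeig L n

/-- `GBx L d (n+1) = G^B_n`, and `GBx L d 0 = G^B_{-1}`. -/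
def GBx [Nonempty V] (L : Labeling G φ a b) (d : ℕ) : ℕ → EIG V α
  | 0 => baseEIG V b d
  | n + 1 => GBeig L n

/-- `Cx L (n+1) = C_n`, and `Cx L 0 = C_{-1}` (the class of the empty ball). -/
def Cx (L : Labeling G φ a b) : ℕ → Set V
  | 0 => Set.univ
  | n + 1 => L.C n

/-! ## Concatenations -/

/-- The `(i)`-concatenation of two edge-indexed graphs at the end vertices `v, v'`
(which are identified). -/
def concatI (X Y : EIG V α) (v : X.Vert) (v' : Y.Vert) (i : ℕ) : EIG V α where
  Vert := X.Vert ⊕ {w : Y.Vert // w ≠ v'}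
  idx := fun p q =>
    match p, q with
    | Sum.inl u, Sum.inl w =>
        if u = v ∧ w ≠ v then (if X.idx u w = 0 then 0 else i) else X.idx u w
    | Sum.inl u, Sum.inr w => if u = v then Y.idx v' w.1 - i else 0
    | Sum.inr w, Sum.inl u => if u = v then Y.idx w.1 v' else 0
    | Sum.inr w, Sum.inr w2 => Y.idx w.1 w2.1
  col := Sum.elim X.col (fun w => Y.col w.1)
  lab := Sum.elim X.lab (fun w => Y.lab w.1)

/-- The `(i,j)`-concatenation of two edge-indexed graphs at the end vertices `v, v'`
(which stay distinct, joined by a new edge of indices `i`, `j`). -/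
def concatIJ (X Y : EIG V α) (v : X.Vert) (v' : Y.Vert) (i j : ℕ) : EIG V α where
  Vert := X.Vert ⊕ Y.Vert
  idx := fun p q =>
    match p, q with
    | Sum.inl u, Sum.inl w => if u = v ∧ w = v then X.idx v v - i else X.idx u w
    | Sum.inl u, Sum.inr w => if u = v ∧ w = v' then i else 0
    | Sum.inr w, Sum.inl u => if w = v' ∧ u = v then j else 0
    | Sum.inr u, Sum.inr w => if u = v' ∧ w = v' then Y.idx v' v' - j else Y.idx u w
  col := Sum.elim X.col Y.col
  lab := Sum.elim X.lab Y.lab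

/-- `Z` is a concatenation ((i)- or (i,j)-) of `X` and `Y` at `(vX, vY)`. -/
def IsConcatOfAt (Z X Y : EIG V α) (vX : X.Vert) (vY : Y.Vert) : Prop :=
  (∃ i, 1 ≤ i ∧ Nonempty (EIGIso Z (concatI X Y vX vY i))) ∨
  (∃ i j, 1 ≤ i ∧ 1 ≤ j ∧ Nonempty (EIGIso Z (concatIJ X Y vX vY i j)))

/-! ## Paths, distance, degree in edge-indexed graphs -/

/-- Adjacency (by an edge of positive index, in one of the two orientations). -/
def EIGAdj (X : EIG V α) (u w : X.Vert) : Prop :=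
  u ≠ w ∧ (0 < X.idx u w ∨ 0 < X.idx w u)

/-- There is a path of length `L` from `u` to `w`. -/
def EIGReach (X : EIG V α) (u w : X.Vert) (L : ℕ) : Prop :=
  ∃ c : ℕ → X.Vert, c 0 = u ∧ c L = w ∧ ∀ i < L, EIGAdj X (c i) (c (i + 1))

/-- Graph distance in an edge-indexed graph. -/
def EIGDist (X : EIG V α) (u w : X.Vert) : ℕ :=
  sInf {L | EIGReach X u w L}

/-- `u` has degree one: there is exactly one vertex adjacent to it. -/
def EIGEndVert (X : EIG V α) (u : X.Vert) : Prop :=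
  ∃! w, EIGAdj X u w

/-! ## Coverings, direct limits, quotient graph, bounded type -/

/-- `p` exhibits the graph `H` as the universal cover of the edge-indexed graph `Y`:
above a vertex mapping to `u`, the number of neighbors above `w` is the index `idx u w`. -/
def IsEIGCover {W : Type} (H : SimpleGraph W) (Y : EIG V α) (p : W → Y.Vert) : Prop :=
  ∀ x : W, ∀ u : Y.Vert, (H.neighborSet x ∩ p ⁻¹' {u}).ncard = Y.idx (p x) u

/-- `Y` is the direct limit of the system `F` of colored edge-indexed graphs along the
inclusions `ι`. -/
def IsDirLimit (F : ℕ → EIG V α) (ι : ∀ k, (F k).Vert → (F (k + 1)).Vert)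
    (Y : EIG V α) : Prop :=
  ∃ j : ∀ k, (F k).Vert → Y.Vert,
    (∀ k v, j (k + 1) (ι k v) = j k v) ∧
    (∀ k, Function.Injective (j k)) ∧
    (∀ y, ∃ k v, j k v = y) ∧
    (∀ k v, Y.col (j k v) = (F k).col v) ∧
    (∀ y z : Y.Vert, ∃ N, ∀ k, N ≤ k → ∀ v w, j k v = y → j k w = z →
      Y.idx y z = (F k).idx v w)

/-- The coloring `φ` is of bounded type: every vertex has finite type set. -/
def BoundedType (G : SimpleGraph V) (φ : V → α) : Prop :=
  ∀ v : V, {m : ℕ | IsSpecialVert G φ m v}.Finite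

/-- Two vertices are related if some color-preserving automorphism maps one to the other. -/
def colorOrbitRel (G : SimpleGraph V) (φ : V → α) (x y : V) : Prop :=
  ∃ g : V ≃ V, (∀ u w, G.Adj u w ↔ G.Adj (g u) (g w)) ∧ (∀ u, φ (g u) = φ u) ∧ g x = y

/-- The quotient graph `X_φ = G\T` as a colored edge-indexed graph. -/
def quotEIG (G : SimpleGraph V) (φ : V → α) : EIG V α where
  Vert := Quot (colorOrbitRel G φ)
  idx := fun u w => (G.neighborSet u.out ∩ {z | Quot.mk (colorOrbitRel G φ) z = w}).ncard
  col := fun u => φ u.out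
  lab := fun u => {z | Quot.mk (colorOrbitRel G φ) z = u}

/-! ## The sequences `n_k`, `α_k`, `β_k` -/

/-- At level `n`, one of `A_n, B_n` is `S_n` or `C_n`. -/
def SpecTouch (L : Labeling G φ a b) (n : ℕ) : Prop :=
  L.A n = L.S n ∨ L.A n = L.C n ∨ L.B n = L.S n ∨ L.B n = L.C n

/-- `nk` is the increasing enumeration of the levels where `SpecTouch` holds. -/
def IsNkSeq (L : Labeling G φ a b) (nk : ℕ → ℕ) : Prop :=
  StrictMono nk ∧ ∀ n, (∃ k, nk k = n) ↔ SpecTouch L n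

/-- `αs` is the sequence `α_k`: `α_K = A`, and for `k ≠ K`, `α_k` is the side whose
graph `G^{α_k}_{n_k}` has more vertices. -/
def IsAlphaSeq (L : Labeling G φ a b) (nk : ℕ → ℕ) (K : ℕ∞) (αs : ℕ → Bool) : Prop :=
  ∀ k : ℕ, ((k : ℕ∞) = K → αs k = true) ∧
    ((k : ℕ∞) ≠ K → (αs k = true ↔
      (VGside L (nk k) false).ncard < (VGside L (nk k) true).ncard))

/-- The sequence `β_k(t)`: `β_{k-1}(t)` is the letter `ᾱ_k` if the class of the
`n_k`-ball at `t` is a vertex of `G^{ᾱ_k}_{n_k}`, and `α_k` otherwise. -/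
def betaOf (L : Labeling G φ a b) (nk : ℕ → ℕ) (αs : ℕ → Bool) (t : V) (k : ℕ) : Bool :=
  if ballClass G φ (nk (k + 1)) t ∈ VGside L (nk (k + 1)) (!(αs (k + 1))) then
    !(αs (k + 1))
  else αs (k + 1)

end Sturm

namespace Sturm

section

variable {V α : Type} {G : SimpleGraph V} {φ : V → α} {a b : α}

/-- `E` is one of the classes of level `n`. -/
def IsCl (cl : ℕ → V → Set V) (n : ℕ) (E : Set V) : Prop := ∃ x, E = cl n x

/-- `x` has a neighbor in `E`. -/
def Sees (G : SimpleGraph V) (x : V) (E : Set V) : Prop := ∃ y, G.Adj x y ∧ y ∈ E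

/-- The combinatorial properties of the classes of balls of a Sturmian coloring: a sequence of
finer and finer partitions, each obtained from the previous one by splitting the class `S n` into
`A (n + 1)` and `B (n + 1)`. -/
structure Evolution (G : SimpleGraph V) (cl : ℕ → V → Set V) (S C A B : ℕ → Set V) : Prop where
  mem_self : ∀ n x, x ∈ cl n x
  eq_of_mem : ∀ {n x y}, y ∈ cl n x → cl n y = cl n x
  refinement : ∀ n x, cl (n + 1) x ⊆ cl n x
  sees_of_mem : ∀ {n x y E}, y ∈ cl (n + 1) x → IsCl cl n E → Sees G x E → Sees G y E
  isCl_S : ∀ n, IsCl cl n (S n)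
  isCl_A : ∀ n, IsCl cl n (A n)
  isCl_B : ∀ n, IsCl cl n (B n)
  isCl_C : ∀ n, IsCl cl n (C n)
  split : ∀ n, S n = A (n + 1) ∪ B (n + 1)
  A_ne_B : ∀ n, A (n + 1) ≠ B (n + 1)
  stable : ∀ {n x}, x ∉ S n → cl (n + 1) x = cl n x
  S_sub_C : ∀ n, S (n + 1) ⊆ C n
  A_sees : ∀ n, ∀ x ∈ A (n + 1), Sees G x (A n)
  B_sees : ∀ n, ∀ x ∈ B (n + 1), Sees G x (B n)

lemma CanAdj.symm {D E : Set V} (h : CanAdj G D E) : CanAdj G E D := by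
  obtain ⟨x, hx, y, hy, hxy⟩ := h
  exact ⟨y, hy, x, hx, hxy.symm⟩

lemma CanAdj.mono {D E D' E' : Set V} (h : CanAdj G D E) (hD : D ⊆ D') (hE : E ⊆ E') :
    CanAdj G D' E' := by
  obtain ⟨x, hx, y, hy, hxy⟩ := h
  exact ⟨x, hD hx, y, hE hy, hxy⟩

lemma CanAdj.of_sees {D E : Set V} {x : V} (hx : x ∈ D) (h : Sees G x E) : CanAdj G D E := by
  obtain ⟨y, hxy, hy⟩ := h
  exact ⟨x, hx, y, hy, hxy⟩

lemma Sees.mono {D E : Set V} {x : V} (h : Sees G x D) (hDE : D ⊆ E) : Sees G x E := by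
  obtain ⟨y, hxy, hy⟩ := h
  exact ⟨y, hxy, hDE hy⟩

namespace Evolution

variable {cl : ℕ → V → Set V} {S C A B : ℕ → Set V}

lemma swap (h : Evolution G cl S C A B) : Evolution G cl S C B A where
  mem_self := h.mem_self
  eq_of_mem := h.eq_of_mem
  refinement := h.refinement
  sees_of_mem := h.sees_of_mem
  isCl_S := h.isCl_S
  isCl_A := h.isCl_B
  isCl_B := h.isCl_A
  isCl_C := h.isCl_C
  split n := by rw [h.split, Set.union_comm]
  A_ne_B n := (h.A_ne_B n).symm
  stable := h.stable
  S_sub_C := h.S_sub_C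
  A_sees := h.B_sees
  B_sees := h.A_sees

lemma isCl_cl (_h : Evolution G cl S C A B) (n : ℕ) (x : V) : IsCl cl n (cl n x) := ⟨x, rfl⟩

lemma eq_cl (h : Evolution G cl S C A B) {n : ℕ} {E : Set V} {x : V} (hE : IsCl cl n E)
    (hx : x ∈ E) : E = cl n x := by
  obtain ⟨y, rfl⟩ := hE
  exact (h.eq_of_mem hx).symm

lemma eq_of_meet (h : Evolution G cl S C A B) {n : ℕ} {D E : Set V} {x : V} (hD : IsCl cl n D)
    (hE : IsCl cl n E) (hxD : x ∈ D) (hxE : x ∈ E) : D = E :=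
  (h.eq_cl hD hxD).trans (h.eq_cl hE hxE).symm

lemma nonempty (h : Evolution G cl S C A B) {n : ℕ} {E : Set V} (hE : IsCl cl n E) :
    E.Nonempty := by
  obtain ⟨y, rfl⟩ := hE
  exact ⟨y, h.mem_self n y⟩

lemma eq_of_sub (h : Evolution G cl S C A B) {n : ℕ} {D E F : Set V} (hD : IsCl cl n D)
    (hE : IsCl cl n E) (hF : F.Nonempty) (hFD : F ⊆ D) (hFE : F ⊆ E) : D = E :=
  h.eq_of_meet hD hE (hFD hF.some_mem) (hFE hF.some_mem)

lemma cl_antitone (h : Evolution G cl S C A B) {m n : ℕ} (hmn : m ≤ n) (x : V) :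
    cl n x ⊆ cl m x := by
  induction n, hmn using Nat.le_induction with
  | base => exact subset_rfl
  | succ n _ ih => exact (h.refinement n x).trans ih

lemma sub_of_meet (h : Evolution G cl S C A B) {m n : ℕ} (hmn : m ≤ n) {D E : Set V} {x : V}
    (hD : IsCl cl n D) (hE : IsCl cl m E) (hxD : x ∈ D) (hxE : x ∈ E) : D ⊆ E := by
  rw [h.eq_cl hD hxD, h.eq_cl hE hxE]
  exact h.cl_antitone hmn x

lemma A_sub (h : Evolution G cl S C A B) (n : ℕ) : A (n + 1) ⊆ S n := by
  rw [h.split n]; exact Set.subset_union_left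

lemma B_sub (h : Evolution G cl S C A B) (n : ℕ) : B (n + 1) ⊆ S n := by
  rw [h.split n]; exact Set.subset_union_right

lemma ne_A_succ (h : Evolution G cl S C A B) {n : ℕ} {E : Set V} (hE : IsCl cl n E)
    (hS : E ≠ S n) : E ≠ A (n + 1) := by
  rintro rfl
  exact hS (h.eq_of_sub hE (h.isCl_S n) (h.nonempty (h.isCl_A _)) subset_rfl (h.A_sub n))

lemma ne_B_succ (h : Evolution G cl S C A B) {n : ℕ} {E : Set V} (hE : IsCl cl n E)
    (hS : E ≠ S n) : E ≠ B (n + 1) :=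
  h.swap.ne_A_succ hE hS

lemma isCl_succ (h : Evolution G cl S C A B) {n : ℕ} {E : Set V} (hE : IsCl cl n E)
    (hS : E ≠ S n) : IsCl cl (n + 1) E := by
  obtain ⟨x, rfl⟩ := hE
  refine ⟨x, (h.stable fun hx => hS ?_).symm⟩
  exact h.eq_of_meet (h.isCl_cl n x) (h.isCl_S n) (h.mem_self n x) hx

lemma isCl_cases (h : Evolution G cl S C A B) {n : ℕ} {E : Set V} (hE : IsCl cl (n + 1) E) :
    E = A (n + 1) ∨ E = B (n + 1) ∨ (IsCl cl n E ∧ E ≠ S n) := by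
  obtain ⟨x, rfl⟩ := hE
  by_cases hx : x ∈ S n
  · rw [h.split n] at hx
    rcases hx with hx | hx
    · exact Or.inl (h.eq_of_meet (h.isCl_cl _ _) (h.isCl_A _) (h.mem_self _ _) hx)
    · exact Or.inr (Or.inl (h.eq_of_meet (h.isCl_cl _ _) (h.isCl_B _) (h.mem_self _ _) hx))
  · refine Or.inr (Or.inr ⟨⟨x, h.stable hx⟩, fun hS => hx ?_⟩)
    rw [← hS]
    exact h.mem_self _ _

lemma isCl_pred (h : Evolution G cl S C A B) {n : ℕ} {E : Set V} (hE : IsCl cl (n + 1) E)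
    (hA : E ≠ A (n + 1)) (hB : E ≠ B (n + 1)) : IsCl cl n E ∧ E ≠ S n := by
  rcases h.isCl_cases hE with h' | h' | h'
  exacts [(hA h').elim, (hB h').elim, h']

lemma persist (h : Evolution G cl S C A B) {n l : ℕ} (hnl : n ≤ l) {E : Set V}
    (hE : IsCl cl n E) (hS : ∀ k, n ≤ k → k < l → S k ≠ E) : IsCl cl l E := by
  induction l, hnl using Nat.le_induction with
  | base => exact hE
  | succ l hl ih =>
    exact h.isCl_succ (ih fun k hk hkl => hS k hk (by omega)) (hS l hl (by omega)).symm

lemma ne_A_of_persist (h : Evolution G cl S C A B) {n l : ℕ} (hnl : n < l) {E : Set V}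
    (hE : IsCl cl n E) (hS : ∀ k, n ≤ k → k < l → S k ≠ E) : E ≠ A l := by
  obtain ⟨l, rfl⟩ : ∃ l', l = l' + 1 := ⟨l - 1, by omega⟩
  exact h.ne_A_succ (h.persist (by omega) hE fun k hk hkl => hS k hk (by omega))
    (hS l (by omega) (by omega)).symm

lemma ne_B_of_persist (h : Evolution G cl S C A B) {n l : ℕ} (hnl : n < l) {E : Set V}
    (hE : IsCl cl n E) (hS : ∀ k, n ≤ k → k < l → S k ≠ E) : E ≠ B l :=
  h.swap.ne_A_of_persist hnl hE hS

lemma exists_first_visit {n : ℕ} (P : ℕ → Prop) (hP : ∃ m, n ≤ m ∧ P m) :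
    ∃ l, n ≤ l ∧ P l ∧ ∀ k, n ≤ k → k < l → ¬ P k :=
  ⟨Nat.find hP, (Nat.find_spec hP).1, (Nat.find_spec hP).2,
    fun _ hk hkl hPk => Nat.find_min hP hkl ⟨hk, hPk⟩⟩

/-- If a class of level `n + 1` touches a class of level `n`, then all of its points see it. -/
lemma sees_of_canAdj (h : Evolution G cl S C A B) {n : ℕ} {D E : Set V} (hD : IsCl cl (n + 1) D)
    (hE : IsCl cl n E) (hDE : CanAdj G D E) : ∀ x ∈ D, Sees G x E := by
  obtain ⟨x, hx, y, hy, hxy⟩ := hDE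
  intro z hz
  rw [h.eq_cl hD hx] at hz
  exact h.sees_of_mem hz hE ⟨y, hxy, hy⟩

lemma sees_of_canAdj' (h : Evolution G cl S C A B) {n : ℕ} {D E : Set V} (hD : IsCl cl n D)
    (hS : D ≠ S n) (hE : IsCl cl n E) (hDE : CanAdj G D E) : ∀ x ∈ D, Sees G x E :=
  h.sees_of_canAdj (h.isCl_succ hD hS) hE hDE

/-- A class older than `F` which touches `F` touches every nonempty subset of `F`. -/
lemma canAdj_sub (h : Evolution G cl S C A B) {n : ℕ} {D F F' : Set V} (hD : IsCl cl n D)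
    (hF : IsCl cl (n + 1) F) (hFD : CanAdj G D F) (hF' : F' ⊆ F) (hne : F'.Nonempty) :
    CanAdj G D F' := by
  obtain ⟨x, hx⟩ := hne
  exact (CanAdj.of_sees hx (h.sees_of_canAdj hF hD hFD.symm x (hF' hx))).symm

lemma canAdj_A (h : Evolution G cl S C A B) {n : ℕ} (hn : 1 ≤ n) {D : Set V} (hD : IsCl cl n D)
    (hA : D ≠ A n) (hB : D ≠ B n) (hDS : CanAdj G D (S n)) : CanAdj G D (A (n + 1)) := by
  obtain ⟨n, rfl⟩ : ∃ n', n = n' + 1 := ⟨n - 1, by omega⟩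
  exact h.canAdj_sub (h.isCl_pred hD hA hB).1 (h.isCl_S _) hDS (h.A_sub _)
    (h.nonempty (h.isCl_A _))

lemma canAdj_B (h : Evolution G cl S C A B) {n : ℕ} (hn : 1 ≤ n) {D : Set V} (hD : IsCl cl n D)
    (hA : D ≠ A n) (hB : D ≠ B n) (hDS : CanAdj G D (S n)) : CanAdj G D (B (n + 1)) :=
  h.swap.canAdj_A hn hD hB hA hDS

lemma canAdj_child (h : Evolution G cl S C A B) {n : ℕ} {D : Set V} (hD : CanAdj G D (S n)) :
    CanAdj G D (A (n + 1)) ∨ CanAdj G D (B (n + 1)) := by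
  obtain ⟨x, hx, y, hy, hxy⟩ := hD
  rw [h.split n] at hy
  exact hy.imp (fun hy => ⟨x, hx, y, hy, hxy⟩) (fun hy => ⟨x, hx, y, hy, hxy⟩)

lemma S_succ_of_ne (h : Evolution G cl S C A B) {n : ℕ} (hC : C n ≠ S n) : S (n + 1) = C n :=
  h.eq_of_sub (h.isCl_S _) (h.isCl_succ (h.isCl_C n) hC) (h.nonempty (h.isCl_S _)) subset_rfl
    (h.S_sub_C n)

lemma S_succ_of_eq (h : Evolution G cl S C A B) {n : ℕ} (hC : C n = S n) :
    S (n + 1) = A (n + 1) ∨ S (n + 1) = B (n + 1) := by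
  obtain ⟨x, hx⟩ := h.nonempty (h.isCl_S (n + 1))
  have hx' := h.S_sub_C n hx
  rw [hC, h.split] at hx'
  exact hx'.imp (h.eq_of_meet (h.isCl_S _) (h.isCl_A _) hx)
    (h.eq_of_meet (h.isCl_S _) (h.isCl_B _) hx)

lemma S_succ_ne (h : Evolution G cl S C A B) {n : ℕ} {D : Set V} (hD : IsCl cl n D)
    (hC : D ≠ C n) : S (n + 1) ≠ D := by
  rintro rfl
  exact hC (h.eq_of_sub hD (h.isCl_C n) (h.nonempty hD) subset_rfl (h.S_sub_C n))

/-- A class touching both children of `S n` which is not split at the next level sees both of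
them from each of its points. -/
lemma sees_child (h : Evolution G cl S C A B) {n : ℕ} {D E : Set V} (hD : IsCl cl n D)
    (hS : D ≠ S n) (hC : D ≠ C n) (hE : IsCl cl (n + 1) E) (hDE : CanAdj G D E) :
    ∀ x ∈ D, Sees G x E :=
  h.sees_of_canAdj' (h.isCl_succ hD hS) (h.S_succ_ne hD hC).symm hE hDE

end Evolution

lemma exists_adj_dist_le (hG : G.Connected) {u z : V} {k : ℕ} (h : G.dist u z = k + 1) :
    ∃ w, G.Adj w z ∧ G.dist u w ≤ k := by
  obtain ⟨p, hp⟩ := hG.exists_walk_length_eq_dist z u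
  rw [SimpleGraph.dist_comm, h] at hp
  cases p with
  | nil => simp at hp
  | cons hadj q =>
    refine ⟨_, hadj.symm, ?_⟩
    rw [SimpleGraph.dist_comm]
    refine (SimpleGraph.dist_le q).trans ?_
    simp only [SimpleGraph.Walk.length_cons] at hp
    omega

lemma dist_map_le (hG : G.Connected) {N : ℕ} {x y : V}
    (f : {z : V // G.dist x z ≤ N} ≃ {z : V // G.dist y z ≤ N})
    (hf : ∀ u v, G.Adj u.1 v.1 ↔ G.Adj (f u).1 (f v).1) {n : ℕ}
    (u : {z : V // G.dist x z ≤ N}) (hu : G.dist x u.1 + n ≤ N) :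
    ∀ k ≤ n, ∀ z : {z : V // G.dist x z ≤ N}, G.dist u.1 z.1 ≤ k →
      G.dist (f u).1 (f z).1 ≤ k := by
  intro k
  induction k with
  | zero =>
    intro _ z hz
    have : u = z := Subtype.ext ((hG.dist_eq_zero_iff).1 (Nat.le_zero.1 hz))
    rw [this, SimpleGraph.dist_self]
  | succ k ih =>
    intro hk z hz
    rcases Nat.lt_or_ge (G.dist u.1 z.1) (k + 1) with hlt | hge
    · exact (ih (by omega) z (by omega)).trans (by omega)
    · obtain ⟨w, hwz, hw⟩ := exists_adj_dist_le hG (le_antisymm hz hge)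
      have hxw : G.dist x w ≤ N := (hG.dist_triangle (v := u.1)).trans (by omega)
      have h1 := ih (by omega) ⟨w, hxw⟩ hw
      have h2 := (hf ⟨w, hxw⟩ z).1 hwz
      have h3 := SimpleGraph.dist_eq_one_iff_adj.2 h2
      exact (hG.dist_triangle (v := (f ⟨w, hxw⟩).1)).trans (by omega)

lemma BallEquiv.of_iso (hG : G.Connected) {N : ℕ} {x y : V}
    (f : {z : V // G.dist x z ≤ N} ≃ {z : V // G.dist y z ≤ N})
    (hf : ∀ u v, G.Adj u.1 v.1 ↔ G.Adj (f u).1 (f v).1) (hφ : ∀ u, φ (f u).1 = φ u.1) {n : ℕ}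
    (u : {z : V // G.dist x z ≤ N}) (hu : G.dist x u.1 + n ≤ N)
    (hfu : G.dist y (f u).1 + n ≤ N) : BallEquiv G φ n u.1 (f u).1 := by
  have hf' : ∀ u v, G.Adj u.1 v.1 ↔ G.Adj (f.symm u).1 (f.symm v).1 := fun u v => by
    rw [hf, f.apply_symm_apply, f.apply_symm_apply]
  have hx : ∀ z, G.dist u.1 z ≤ n → G.dist x z ≤ N := fun z hz =>
    (hG.dist_triangle (v := u.1)).trans (by omega)
  have hy : ∀ z, G.dist (f u).1 z ≤ n → G.dist y z ≤ N := fun z hz =>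
    (hG.dist_triangle (v := (f u).1)).trans (by omega)
  refine ⟨⟨fun z => ⟨f ⟨z.1, hx _ z.2⟩, dist_map_le hG f hf u hu n le_rfl _ z.2⟩,
    fun z => ⟨f.symm ⟨z.1, hy _ z.2⟩, ?_⟩, fun z => ?_, fun z => ?_⟩, fun v w => ?_,
    fun v => ?_, rfl⟩
  · simpa using dist_map_le hG f.symm hf' (f u) hfu n le_rfl ⟨z.1, hy _ z.2⟩ z.2
  · simp
  · simp
  · exact hf ⟨v.1, hx _ v.2⟩ ⟨w.1, hx _ w.2⟩
  · exact hφ ⟨v.1, hx _ v.2⟩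

lemma BallEquiv.refl (n : ℕ) (x : V) : BallEquiv G φ n x x :=
  ⟨Equiv.refl _, fun _ _ => Iff.rfl, fun _ => rfl, rfl⟩

lemma BallEquiv.symm {n : ℕ} {x y : V} (h : BallEquiv G φ n x y) : BallEquiv G φ n y x := by
  obtain ⟨f, hf, hφ, hxy⟩ := h
  refine ⟨f.symm, fun u v => ?_, fun u => ?_, ?_⟩
  · rw [hf, f.apply_symm_apply, f.apply_symm_apply]
  · rw [← hφ, f.apply_symm_apply]
  · rw [← show f _ = ⟨y, _⟩ from Subtype.ext hxy, f.symm_apply_apply]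

lemma BallEquiv.trans {n : ℕ} {x y z : V} (h : BallEquiv G φ n x y) (h' : BallEquiv G φ n y z) :
    BallEquiv G φ n x z := by
  obtain ⟨f, hf, hφ, hxy⟩ := h
  obtain ⟨g, hg, hφ', hyz⟩ := h'
  refine ⟨f.trans g, fun u v => ?_, fun u => ?_, ?_⟩
  · rw [hf, hg]; rfl
  · exact (hφ' _).trans (hφ _)
  · exact (congrArg (fun t => (g t).1) (Subtype.ext hxy)).trans hyz

lemma BallEquiv.restrict (hG : G.Connected) {n : ℕ} {x y : V} (h : BallEquiv G φ (n + 1) x y) :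
    BallEquiv G φ n x y := by
  obtain ⟨f, hf, hφ, hxy⟩ := h
  have := BallEquiv.of_iso hG f hf hφ (n := n) ⟨x, by simp⟩ (by simp) (by rw [hxy]; simp)
  rwa [hxy] at this

lemma BallEquiv.exists_neighbor (hG : G.Connected) {n : ℕ} {x y x' : V}
    (h : BallEquiv G φ (n + 1) x y) (hx : G.Adj x x') :
    ∃ y', G.Adj y y' ∧ BallEquiv G φ n x' y' := by
  obtain ⟨f, hf, hφ, hxy⟩ := h
  have h1 := SimpleGraph.dist_eq_one_iff_adj.2 hx
  have hadj := (hf ⟨x, by simp⟩ ⟨x', by omega⟩).1 hx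
  rw [hxy] at hadj
  refine ⟨_, hadj, BallEquiv.of_iso hG f hf hφ ⟨x', by omega⟩ (by simp only; omega) ?_⟩
  have := SimpleGraph.dist_eq_one_iff_adj.2 hadj
  omega

lemma mem_ballClass_self (n : ℕ) (x : V) : x ∈ ballClass G φ n x := BallEquiv.refl n x

lemma ballClass_eq {n : ℕ} {x y : V} (h : y ∈ ballClass G φ n x) :
    ballClass G φ n y = ballClass G φ n x :=
  Set.ext fun _ => ⟨fun hz => BallEquiv.trans h hz, fun hz => BallEquiv.trans (BallEquiv.symm h) hz⟩

lemma ballClass_eq_iff {n : ℕ} {x y : V} :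
    ballClass G φ n x = ballClass G φ n y ↔ BallEquiv G φ n x y :=
  ⟨fun h => by
    have : y ∈ ballClass G φ n x := h ▸ mem_ballClass_self n y
    exact this, fun h => (ballClass_eq h).symm⟩

lemma IsSturmian.finite (hSt : IsSturmian G φ) (n : ℕ) : (ballClasses G φ n).Finite :=
  Set.finite_of_ncard_ne_zero (by rw [hSt n]; omega)

/-- If `X` and `Y` are distinct classes of `(n + 1)`-balls with the same restriction, then every
class of `(n + 1)`-balls other than `Y` is determined by its restriction. -/
lemma eq_of_restrict_eq (hG : G.Connected) (hSt : IsSturmian G φ) {n : ℕ} {x y : V}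
    (hxy : BallEquiv G φ n x y) (hne : ¬ BallEquiv G φ (n + 1) x y) {u v : V}
    (huv : BallEquiv G φ n u v) (hu : ¬ BallEquiv G φ (n + 1) u y)
    (hv : ¬ BallEquiv G φ (n + 1) v y) : BallEquiv G φ (n + 1) u v := by
  set P := ballClasses G φ (n + 1) \ {ballClass G φ (n + 1) y} with hP
  have hPfin : P.Finite := (hSt.finite _).subset Set.sdiff_subset
  let r : Set V → Set V := fun E => {z | ∃ w ∈ E, BallEquiv G φ n w z}
  have hr : ∀ z, r (ballClass G φ (n + 1) z) = ballClass G φ n z := fun z => by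
    ext w
    exact ⟨fun ⟨t, ht, htw⟩ => (BallEquiv.restrict hG ht).trans htw,
      fun hw => ⟨z, mem_ballClass_self _ z, hw⟩⟩
  have himg : r '' P = ballClasses G φ n := by
    apply Set.Subset.antisymm
    · rintro _ ⟨_, ⟨⟨z, rfl⟩, _⟩, rfl⟩
      exact ⟨z, hr z⟩
    · rintro _ ⟨z, rfl⟩
      by_cases hz : BallEquiv G φ (n + 1) z y
      · refine ⟨ballClass G φ (n + 1) x, ⟨⟨x, rfl⟩, fun h => hne (ballClass_eq_iff.1 h)⟩, ?_⟩
        rw [hr]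
        exact ballClass_eq_iff.2 (hxy.trans (BallEquiv.restrict hG hz).symm)
      · exact ⟨ballClass G φ (n + 1) z, ⟨⟨z, rfl⟩, fun h => hz (ballClass_eq_iff.1 h)⟩, hr z⟩
  have hcard : P.ncard = n + 2 := by
    rw [hP, Set.ncard_sdiff_singleton_of_mem (show _ ∈ ballClasses G φ (n + 1) from ⟨y, rfl⟩),
      hSt]
    omega
  have hinj : Set.InjOn r P := Set.injOn_of_ncard_image_eq (by rw [himg, hcard, hSt]) hPfin
  exact ballClass_eq_iff.1 (hinj ⟨⟨u, rfl⟩, fun h => hu (ballClass_eq_iff.1 h)⟩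
    ⟨⟨v, rfl⟩, fun h => hv (ballClass_eq_iff.1 h)⟩
    (by rw [hr, hr]; exact ballClass_eq_iff.2 huv))

lemma Labeling.evolution (hG : G.Connected) (hSt : IsSturmian G φ) (L : Labeling G φ a b) :
    Evolution G (ballClass G φ) L.S L.C L.A L.B := by
  have key : ∀ n, ∃ x y, L.S n = ballClass G φ n x ∧ L.A (n + 1) = ballClass G φ (n + 1) x ∧
      L.B (n + 1) = ballClass G φ (n + 1) y ∧ BallEquiv G φ n x y ∧
      ¬ BallEquiv G φ (n + 1) x y := fun n => by
    obtain ⟨x, _, hSx, hA⟩ := L.A_ext n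
    obtain ⟨y, _, hSy, hB⟩ := L.B_ext n
    refine ⟨x, y, hSx, hA, hB, ballClass_eq_iff.1 (hSx.symm.trans hSy), fun h => L.AB_ne n ?_⟩
    rw [hA, hB, ballClass_eq_iff.2 h]
  have hAB : ∀ n, IsCl (ballClass G φ) n (L.A n) ∧ IsCl (ballClass G φ) n (L.B n) := fun n => by
    cases n with
    | zero =>
      obtain ⟨x, _, hx⟩ := L.A0_col
      obtain ⟨y, _, hy⟩ := L.B0_col
      exact ⟨⟨x, hx⟩, ⟨y, hy⟩⟩
    | succ n =>
      obtain ⟨x, y, _, hA, hB, _⟩ := key n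
      exact ⟨⟨x, hA⟩, ⟨y, hB⟩⟩
  refine
    { mem_self := mem_ballClass_self
      eq_of_mem := ballClass_eq
      refinement := fun n x y hy => BallEquiv.restrict hG hy
      sees_of_mem := ?_
      isCl_S := fun n => ?_
      isCl_A := fun n => (hAB n).1
      isCl_B := fun n => (hAB n).2
      isCl_C := fun n => ?_
      split := fun n => ?_
      A_ne_B := L.AB_ne
      stable := ?_
      S_sub_C := fun n => ?_
      A_sees := L.A_adj
      B_sees := L.B_adj }
  · rintro n x y _ hy ⟨z, rfl⟩ ⟨x', hx', hz⟩
    obtain ⟨y', hy', h⟩ := BallEquiv.exists_neighbor hG hy hx'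
    exact ⟨y', hy', BallEquiv.trans hz h⟩
  · obtain ⟨x, hx, _⟩ := L.S_special n
    exact ⟨x, hx⟩
  · obtain ⟨x, _, _, hx⟩ := L.C_central n
    exact ⟨x, hx⟩
  · obtain ⟨x, y, hS, hA, hB, hxy, hne⟩ := key n
    rw [hS, hA, hB]
    ext z
    constructor
    · intro hz
      by_cases hzy : BallEquiv G φ (n + 1) z y
      · exact Or.inr hzy.symm
      · exact Or.inl (eq_of_restrict_eq hG hSt hxy hne hz hne hzy)
    · rintro (hz | hz)
      · exact BallEquiv.restrict hG hz
      · exact hxy.trans (BallEquiv.restrict hG hz)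
  · intro n z hz
    obtain ⟨x, y, hS, hA, hB, hxy, hne⟩ := key n
    rw [hS] at hz
    refine Set.Subset.antisymm (fun w hw => BallEquiv.restrict hG hw) fun w hw => ?_
    have hz' : ¬ BallEquiv G φ (n + 1) z y := fun h =>
      hz (hxy.trans (BallEquiv.restrict hG h).symm)
    have hw' : ¬ BallEquiv G φ (n + 1) w y := fun h =>
      hz (hxy.trans ((BallEquiv.trans hw (BallEquiv.restrict hG h)).symm))
    exact eq_of_restrict_eq hG hSt hxy hne hw hz' hw'
  · obtain ⟨x, _, hS, hC⟩ := L.C_central n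
    rw [hS, hC]
    exact fun y hy => BallEquiv.restrict hG hy

lemma hasCycle_three {n : ℕ} {X Y Z : Set V} (hX : X ∈ ballClasses G φ n)
    (hY : Y ∈ ballClasses G φ n) (hZ : Z ∈ ballClasses G φ n) (hXY : CanAdj G X Y)
    (hYZ : CanAdj G Y Z) (hZX : CanAdj G Z X) (nXY : X ≠ Y) (nYZ : Y ≠ Z) (nXZ : X ≠ Z) :
    HasCycle G φ n := by
  refine ⟨3, fun i => match i with | 0 => X | 1 => Y | _ => Z, le_rfl, ?_, ?_, ?_⟩
  · intro i hi
    interval_cases i <;> assumption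
  · intro i hi
    interval_cases i <;> assumption
  · intro i hi j hj
    interval_cases i <;> interval_cases j <;> simp [nXY, nYZ, nXZ, nXY.symm, nYZ.symm, nXZ.symm]

lemma hasCycle_four {n : ℕ} {X Y Z W : Set V} (hX : X ∈ ballClasses G φ n)
    (hY : Y ∈ ballClasses G φ n) (hZ : Z ∈ ballClasses G φ n) (hW : W ∈ ballClasses G φ n)
    (hXY : CanAdj G X Y) (hYZ : CanAdj G Y Z) (hZW : CanAdj G Z W) (hWX : CanAdj G W X)
    (nXY : X ≠ Y) (nXZ : X ≠ Z) (nXW : X ≠ W) (nYZ : Y ≠ Z) (nYW : Y ≠ W) (nZW : Z ≠ W) :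
    HasCycle G φ n := by
  refine ⟨4, fun i => match i with | 0 => X | 1 => Y | 2 => Z | _ => W, by omega, ?_, ?_, ?_⟩
  · intro i hi
    interval_cases i <;> assumption
  · intro i hi
    interval_cases i <;> assumption
  · intro i hi j hj
    interval_cases i <;> interval_cases j <;>
      simp [nXY, nXZ, nXW, nYZ, nYW, nZW, nXY.symm, nXZ.symm, nXW.symm, nYZ.symm, nYW.symm,
        nZW.symm]

lemma Evolution.hasCycle {S C A B : ℕ → Set V} (h : Evolution G (ballClass G φ) S C A B) {n : ℕ}
    {D : Set V} (hD : IsCl (ballClass G φ) n D) (hS : D ≠ S n) (hC : D ≠ C n)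
    (hDA : CanAdj G D (A (n + 1))) (hDB : CanAdj G D (B (n + 1))) : HasCycle G φ (n + 1) := by
  have hD' := h.isCl_succ hD hS
  have nA := h.ne_A_succ hD hS
  have nB := h.ne_B_succ hD hS
  by_cases hCS : C n = S n
  · have hAB : CanAdj G (A (n + 1)) (B (n + 1)) := by
      rcases h.S_succ_of_eq hCS with h1 | h1
      · obtain ⟨x, hx⟩ := h.nonempty (h.isCl_B (n + 2))
        exact CanAdj.of_sees (h1 ▸ h.B_sub (n + 1) hx) (h.B_sees _ x hx)
      · obtain ⟨x, hx⟩ := h.nonempty (h.isCl_A (n + 2))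
        exact (CanAdj.of_sees (h1 ▸ h.A_sub (n + 1) hx) (h.A_sees _ x hx)).symm
    exact hasCycle_three hD' (h.isCl_A _) (h.isCl_B _) hDA hAB hDB.symm nA (h.A_ne_B n) nB
  · have h1 := h.S_succ_of_ne hCS
    have h2 := h.isCl_succ (h.isCl_C n) hCS
    obtain ⟨x, hx⟩ := h.nonempty (h.isCl_A (n + 2))
    obtain ⟨y, hy⟩ := h.nonempty (h.isCl_B (n + 2))
    have hAC := (CanAdj.of_sees (h1 ▸ h.A_sub (n + 1) hx) (h.A_sees _ x hx)).symm
    have hBC := CanAdj.of_sees (h1 ▸ h.B_sub (n + 1) hy) (h.B_sees _ y hy)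
    exact hasCycle_four hD' (h.isCl_A _) h2 (h.isCl_B _) hDA hAC hBC hDB.symm nA hC nB
      (h.ne_A_succ (h.isCl_C n) hCS).symm (h.A_ne_B n) (h.ne_B_succ (h.isCl_C n) hCS)

/-- The classes of level `n` not containing `x` in which `x` has a neighbor. -/
def nbrClasses (G : SimpleGraph V) (cl : ℕ → V → Set V) (n : ℕ) (x : V) : Set (Set V) :=
  {E | IsCl cl n E ∧ x ∉ E ∧ Sees G x E}

/-- The number of classes of level `n` not containing `x` in which `x` has a neighbor. -/
def nbrClassCount (G : SimpleGraph V) (cl : ℕ → V → Set V) (n : ℕ) (x : V) : ℕ :=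
  (nbrClasses G cl n x).ncard

namespace Evolution

variable {cl : ℕ → V → Set V} {S C A B : ℕ → Set V}

lemma nbrClasses_subset (h : Evolution G cl S C A B) (n : ℕ) (x : V) :
    nbrClasses G cl n x ⊆ cl n '' G.neighborSet x := by
  rintro E ⟨hE, _, y, hxy, hy⟩
  exact ⟨y, hxy, (h.eq_cl hE hy).symm⟩

lemma nbrClasses_finite (h : Evolution G cl S C A B) (hfin : ∀ x, (G.neighborSet x).Finite)
    (n : ℕ) (x : V) : (nbrClasses G cl n x).Finite :=
  ((hfin x).image _).subset (h.nbrClasses_subset n x)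

lemma count_le (h : Evolution G cl S C A B) (hfin : ∀ x, (G.neighborSet x).Finite) (n : ℕ)
    (x : V) : nbrClassCount G cl n x ≤ (G.neighborSet x).ncard :=
  (Set.ncard_le_ncard (h.nbrClasses_subset n x) ((hfin x).image _)).trans
    (Set.ncard_image_le (hfin x))

/-- The class of level `n` containing some point of `F`. -/
def coarsen (cl : ℕ → V → Set V) (n : ℕ) (F : Set V) : Set V :=
  {z | ∃ w ∈ F, z ∈ cl n w}

lemma coarsen_eq (h : Evolution G cl S C A B) {n : ℕ} {E F : Set V} (hE : IsCl cl n E)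
    (hF : IsCl cl (n + 1) F) (hFE : F ⊆ E) : coarsen cl n F = E := by
  obtain ⟨x, hx⟩ := h.nonempty hF
  ext z
  constructor
  · rintro ⟨w, hw, hz⟩
    rwa [h.eq_cl hE (hFE hw)]
  · intro hz
    exact ⟨x, hx, by rwa [← h.eq_cl hE (hFE hx)]⟩

lemma count_mono_succ (h : Evolution G cl S C A B) (hfin : ∀ x, (G.neighborSet x).Finite) (n : ℕ)
    (x : V) : nbrClassCount G cl n x ≤ nbrClassCount G cl (n + 1) x := by
  have hsub : nbrClasses G cl n x ⊆ coarsen cl n '' nbrClasses G cl (n + 1) x := by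
    rintro E ⟨hE, hx, y, hxy, hy⟩
    have hyE : cl (n + 1) y ⊆ E := h.sub_of_meet (Nat.le_succ n) (h.isCl_cl _ _) hE
      (h.mem_self _ _) hy
    exact ⟨cl (n + 1) y, ⟨h.isCl_cl _ _, fun hx' => hx (hyE hx'), y, hxy, h.mem_self _ _⟩,
      h.coarsen_eq hE (h.isCl_cl _ _) hyE⟩
  exact (Set.ncard_le_ncard hsub ((h.nbrClasses_finite hfin _ _).image _)).trans
    (Set.ncard_image_le (h.nbrClasses_finite hfin _ _))

lemma count_mono (h : Evolution G cl S C A B) (hfin : ∀ x, (G.neighborSet x).Finite) {m n : ℕ}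
    (hmn : m ≤ n) (x : V) : nbrClassCount G cl m x ≤ nbrClassCount G cl n x :=
  monotone_nat_of_le_succ (f := fun k => nbrClassCount G cl k x)
    (fun k => h.count_mono_succ hfin k x) hmn

lemma count_lt (h : Evolution G cl S C A B) (hfin : ∀ x, (G.neighborSet x).Finite) {n : ℕ}
    {x : V} {E₀ F₁ F₂ : Set V} (hE₀ : IsCl cl n E₀) (h₁ : IsCl cl (n + 1) F₁)
    (h₂ : IsCl cl (n + 1) F₂) (hne : F₁ ≠ F₂) (h₁E : F₁ ⊆ E₀) (h₂E : F₂ ⊆ E₀) (hx₂ : x ∉ F₂)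
    (hs₂ : Sees G x F₂) (hx₁ : x ∈ F₁ ∨ Sees G x F₁) :
    nbrClassCount G cl n x < nbrClassCount G cl (n + 1) x := by
  have hmem : F₂ ∈ nbrClasses G cl (n + 1) x := ⟨h₂, hx₂, hs₂⟩
  have hsub : nbrClasses G cl n x ⊆ coarsen cl n '' (nbrClasses G cl (n + 1) x \ {F₂}) := by
    rintro E ⟨hE, hx, y, hxy, hy⟩
    have hyE : cl (n + 1) y ⊆ E := h.sub_of_meet (Nat.le_succ n) (h.isCl_cl _ _) hE
      (h.mem_self _ _) hy
    by_cases hy₂ : cl (n + 1) y = F₂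
    · have hEE : E = E₀ := h.eq_of_meet hE hE₀ hy (h₂E (hy₂ ▸ h.mem_self _ _))
      subst hEE
      have hx₁' : x ∉ F₁ := fun hx' => hx (h₁E hx')
      exact ⟨F₁, ⟨⟨h₁, hx₁', hx₁.resolve_left hx₁'⟩, hne⟩, h.coarsen_eq hE h₁ h₁E⟩
    · exact ⟨cl (n + 1) y, ⟨⟨h.isCl_cl _ _, fun hx' => hx (hyE hx'), y, hxy, h.mem_self _ _⟩, hy₂⟩,
        h.coarsen_eq hE (h.isCl_cl _ _) hyE⟩
  have hfin' := h.nbrClasses_finite hfin (n + 1) x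
  calc nbrClassCount G cl n x ≤ (nbrClasses G cl (n + 1) x \ {F₂}).ncard :=
        (Set.ncard_le_ncard hsub (hfin'.sdiff.image _)).trans (Set.ncard_image_le hfin'.sdiff)
    _ < nbrClassCount G cl (n + 1) x := Set.ncard_sdiff_singleton_lt_of_mem hmem hfin'

lemma count_lt_of_sees (h : Evolution G cl S C A B) (hfin : ∀ x, (G.neighborSet x).Finite) {n : ℕ}
    {x : V} (hx : x ∉ S n) (hA : Sees G x (A (n + 1))) (hB : Sees G x (B (n + 1))) :
    nbrClassCount G cl n x < nbrClassCount G cl (n + 1) x :=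
  h.count_lt hfin (h.isCl_S n) (h.isCl_A _) (h.isCl_B _) (h.A_ne_B n) (h.A_sub n) (h.B_sub n)
    (fun hx' => hx (h.B_sub n hx')) hB (Or.inr hA)

lemma count_lt_of_mem (h : Evolution G cl S C A B) (hfin : ∀ x, (G.neighborSet x).Finite) {n : ℕ}
    {x : V} (hx : x ∈ A (n + 1)) (hB : Sees G x (B (n + 1))) :
    nbrClassCount G cl n x < nbrClassCount G cl (n + 1) x :=
  h.count_lt hfin (h.isCl_S n) (h.isCl_A _) (h.isCl_B _) (h.A_ne_B n) (h.A_sub n) (h.B_sub n)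
    (fun hx' => h.A_ne_B n (h.eq_of_meet (h.isCl_A _) (h.isCl_B _) hx hx')) hB (Or.inl hx)

lemma count_congr (h : Evolution G cl S C A B) {n : ℕ} {x y : V} (hy : y ∈ cl (n + 1) x) :
    nbrClassCount G cl n y = nbrClassCount G cl n x := by
  have key : ∀ {x y}, y ∈ cl (n + 1) x → nbrClasses G cl n x ⊆ nbrClasses G cl n y := by
    rintro x y hy E ⟨hE, hx, hs⟩
    refine ⟨hE, fun hyE => hx ?_, h.sees_of_mem hy hE hs⟩
    rw [h.eq_cl hE hyE, h.eq_of_mem (h.refinement n x hy)]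
    exact h.mem_self n x
  have hx : x ∈ cl (n + 1) y := h.eq_of_mem hy ▸ h.mem_self _ _
  exact congrArg Set.ncard (Set.Subset.antisymm (key hx) (key hy))

lemma three_le_count (h : Evolution G cl S C A B) (hfin : ∀ x, (G.neighborSet x).Finite) {n : ℕ}
    {x : V} {E₁ E₂ E₃ : Set V} (h₁ : E₁ ∈ nbrClasses G cl n x) (h₂ : E₂ ∈ nbrClasses G cl n x)
    (h₃ : E₃ ∈ nbrClasses G cl n x) (h₁₂ : E₁ ≠ E₂) (h₁₃ : E₁ ≠ E₃) (h₂₃ : E₂ ≠ E₃) :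
    3 ≤ nbrClassCount G cl n x := by
  rw [← Set.ncard_eq_three.2 ⟨E₁, E₂, E₃, h₁₂, h₁₃, h₂₃, rfl⟩]
  refine Set.ncard_le_ncard ?_ (h.nbrClasses_finite hfin n x)
  rintro _ (rfl | rfl | rfl) <;> assumption

lemma mem_nbrClasses (h : Evolution G cl S C A B) {n : ℕ} {x : V} {D E : Set V}
    (hD : IsCl cl n D) (hE : IsCl cl n E) (hx : x ∈ D) (hDE : D ≠ E) (hs : Sees G x E) :
    E ∈ nbrClasses G cl n x :=
  ⟨hE, fun hx' => hDE (h.eq_of_meet hD hE hx hx'), hs⟩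

end Evolution

/-- `E` contains infinitely many of the classes `S m`. -/
def Immortal (S : ℕ → Set V) (E : Set V) : Prop := ∀ N, ∃ m, N ≤ m ∧ S m ⊆ E

lemma Immortal.mono {S : ℕ → Set V} {D E : Set V} (hD : Immortal S D) (hDE : D ⊆ E) :
    Immortal S E := fun N => by
  obtain ⟨m, hm, hmD⟩ := hD N
  exact ⟨m, hm, hmD.trans hDE⟩

/-- A class of level `n` distinct from `A n`, `B n`, `C n`, `S n` which touches `S n` and another
class `E`. -/
structure IsBranching (G : SimpleGraph V) (cl : ℕ → V → Set V) (S C A B : ℕ → Set V) (n : ℕ)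
    (D E : Set V) : Prop where
  one_le : 1 ≤ n
  isCl : IsCl cl n D
  ne_A : D ≠ A n
  ne_B : D ≠ B n
  ne_C : D ≠ C n
  ne_S : D ≠ S n
  adj_S : CanAdj G D (S n)
  isCl' : IsCl cl n E
  ne : D ≠ E
  ne_S' : E ≠ S n
  adj : CanAdj G D E

lemma IsBranching.swap {cl : ℕ → V → Set V} {S C A B : ℕ → Set V} {n : ℕ} {D E : Set V}
    (hD : IsBranching G cl S C A B n D E) :
    IsBranching G cl S C B A n D E :=
  ⟨hD.1, hD.2, hD.4, hD.3, hD.5, hD.6, hD.7, hD.8, hD.9, hD.10, hD.11⟩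

namespace Evolution

variable {cl : ℕ → V → Set V} {S C A B : ℕ → Set V}

lemma three_le_count_of_branching (h : Evolution G cl S C A B)
    (hfin : ∀ x, (G.neighborSet x).Finite) {n : ℕ} {D E : Set V}
    (hD : IsBranching G cl S C A B n D E) {x : V} (hx : x ∈ D) :
    3 ≤ nbrClassCount G cl (n + 1) x := by
  have hD' := h.isCl_succ hD.isCl hD.ne_S
  have hE' := h.isCl_succ hD.isCl' hD.ne_S'
  have hA := h.canAdj_A hD.one_le hD.isCl hD.ne_A hD.ne_B hD.adj_S
  have hB := h.canAdj_B hD.one_le hD.isCl hD.ne_A hD.ne_B hD.adj_S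
  exact h.three_le_count hfin
    (h.mem_nbrClasses hD' (h.isCl_A _) hx (h.ne_A_succ hD.isCl hD.ne_S)
      (h.sees_child hD.isCl hD.ne_S hD.ne_C (h.isCl_A _) hA x hx))
    (h.mem_nbrClasses hD' (h.isCl_B _) hx (h.ne_B_succ hD.isCl hD.ne_S)
      (h.sees_child hD.isCl hD.ne_S hD.ne_C (h.isCl_B _) hB x hx))
    (h.mem_nbrClasses hD' hE' hx hD.ne (h.sees_child hD.isCl hD.ne_S hD.ne_C hE' hD.adj x hx))
    (h.A_ne_B n) (h.ne_A_succ hD.isCl' hD.ne_S').symm (h.ne_B_succ hD.isCl' hD.ne_S').symm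

lemma immortal_split (h : Evolution G cl S C A B) {n : ℕ} (hS : Immortal S (S n)) :
    Immortal S (A (n + 1)) ∨ Immortal S (B (n + 1)) := by
  by_contra! hcon
  obtain ⟨hA, hB⟩ := hcon
  simp only [Immortal, not_forall, not_exists, not_and] at hA hB
  obtain ⟨N, hN⟩ := hA
  obtain ⟨M, hM⟩ := hB
  obtain ⟨m, hm, hmS⟩ := hS (N + M + (n + 1))
  obtain ⟨x, hx⟩ := h.nonempty (h.isCl_S m)
  have hx' := hmS hx
  rw [h.split n] at hx'
  rcases hx' with hx' | hx'
  · exact hN m (by omega) (h.sub_of_meet (by omega) (h.isCl_S m) (h.isCl_A _) hx hx')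
  · exact hM m (by omega) (h.sub_of_meet (by omega) (h.isCl_S m) (h.isCl_B _) hx hx')

lemma exists_immortal (h : Evolution G cl S C A B) (hcl : ∀ n, {E | IsCl cl n E}.Finite) (n : ℕ) :
    ∃ E, IsCl cl n E ∧ Immortal S E := by
  by_contra! hcon
  have hev : ∀ᶠ m in Filter.atTop, ∀ E ∈ {E | IsCl cl n E}, ¬ S m ⊆ E := by
    rw [Filter.eventually_all_finite (hcl n)]
    intro E hE
    have := hcon E hE
    simp only [Immortal, not_forall, not_exists, not_and] at this
    obtain ⟨N, hN⟩ := this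
    exact Filter.eventually_atTop.2 ⟨N, hN⟩
  obtain ⟨m, hm, hnm⟩ := (hev.and (Filter.eventually_ge_atTop n)).exists
  obtain ⟨x, hx⟩ := h.nonempty (h.isCl_S m)
  exact hm (cl n x) ⟨x, rfl⟩
    (h.sub_of_meet hnm (h.isCl_S m) (h.isCl_cl n x) hx (h.mem_self n x))

lemma exists_visit (h : Evolution G cl S C A B) {n : ℕ} {E : Set V} (hE : IsCl cl n E)
    (hI : Immortal S E) : ∃ l, n ≤ l ∧ S l = E := by
  by_contra! hcon
  obtain ⟨m, hm, hmE⟩ := hI n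
  exact hcon m hm (h.eq_of_sub (h.isCl_S m) (h.persist hm hE fun k hk _ => hcon k hk)
    (h.nonempty (h.isCl_S m)) subset_rfl hmE)

/-- A class that is never split again has no immortal neighbor, except possibly at its birth. -/
lemma not_canAdj_immortal (h : Evolution G cl S C A B) (hfin : ∀ x, (G.neighborSet x).Finite)
    {N : ℕ} (hN : 1 ≤ N) {g : Set V} (hg : IsCl cl N g) (hS : ∀ m, N ≤ m → S m ≠ g)
    (hA : g ≠ A N) (hB : g ≠ B N) {q : Set V} (hq : IsCl cl N q) (hI : Immortal S q)
    (hgq : CanAdj G g q) : False := by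
  obtain ⟨x, hx⟩ := h.nonempty hg
  have key : ∀ t, ∃ k, N ≤ k ∧ t ≤ nbrClassCount G cl k x ∧
      ∃ q, IsCl cl k q ∧ Immortal S q ∧ CanAdj G g q := by
    intro t
    induction t with
    | zero => exact ⟨N, le_rfl, Nat.zero_le _, q, hq, hI, hgq⟩
    | succ t ih =>
      obtain ⟨k, hk, ht, q, hq, hI, hgq⟩ := ih
      obtain ⟨l, hl, rfl⟩ := h.exists_visit hq hI
      have hNl := hk.trans hl
      have hgl : IsCl cl l g := h.persist hNl hg fun m hm _ => hS m hm
      have hgA : g ≠ A l := by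
        rcases hNl.eq_or_lt with rfl | hlt
        · exact hA
        · exact h.ne_A_of_persist hlt hg fun m hm _ => hS m hm
      have hgB : g ≠ B l := by
        rcases hNl.eq_or_lt with rfl | hlt
        · exact hB
        · exact h.ne_B_of_persist hlt hg fun m hm _ => hS m hm
      have hgS := (hS l hNl).symm
      have hgl' := h.isCl_succ hgl hgS
      have hgS' := (hS (l + 1) (by omega)).symm
      have adjA := h.canAdj_A (by omega) hgl hgA hgB hgq
      have adjB := h.canAdj_B (by omega) hgl hgA hgB hgq
      have hlt := h.count_lt_of_sees hfin
        (fun hx' => hgS (h.eq_of_meet hgl (h.isCl_S l) hx hx'))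
        (h.sees_of_canAdj' hgl' hgS' (h.isCl_A _) adjA x hx)
        (h.sees_of_canAdj' hgl' hgS' (h.isCl_B _) adjB x hx)
      have := h.count_mono hfin hl x
      refine ⟨l + 1, by omega, by omega, ?_⟩
      rcases h.immortal_split hI with hI' | hI'
      · exact ⟨_, h.isCl_A _, hI', adjA⟩
      · exact ⟨_, h.isCl_B _, hI', adjB⟩
  obtain ⟨k, _, hk, _⟩ := key ((G.neighborSet x).ncard + 1)
  have := h.count_le hfin k x
  omega

/-- A region that is eventually not split does not touch an immortal class, provided it contains
both children of a split class as soon as the contact is through one of them. -/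
lemma not_canAdj_region (h : Evolution G cl S C A B) (hfin : ∀ x, (G.neighborSet x).Finite)
    {n : ℕ} (hn : 1 ≤ n) {M : Set V} (hM : ¬ Immortal S M) {g q : Set V} (hg : IsCl cl n g)
    (hgM : g ⊆ M) (hq : IsCl cl n q) (hI : Immortal S q) (hgq : CanAdj G g q)
    (hAB : g = A n ∨ g = B n → A n ⊆ M ∧ B n ⊆ M) : False := by
  have hmort : ∀ {E}, E ⊆ M → ¬ Immortal S E := fun hE hI => hM (hI.mono hE)
  have key : ∀ k, n ≤ k → ∃ g q, IsCl cl k g ∧ g ⊆ M ∧ IsCl cl k q ∧ Immortal S q ∧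
      CanAdj G g q ∧ (g = A k ∨ g = B k → A k ⊆ M ∧ B k ⊆ M) := by
    intro k hk
    induction k, hk using Nat.le_induction with
    | base => exact ⟨g, q, hg, hgM, hq, hI, hgq, hAB⟩
    | succ k hk ih =>
      obtain ⟨g, q, hg, hgM, hq, hI, hgq, hAB⟩ := ih
      have hne : g ≠ q := by
        rintro rfl
        exact hmort hgM hI
      have vac : ∀ {g}, IsCl cl k g → g ≠ S k → (g = A (k + 1) ∨ g = B (k + 1) →
          A (k + 1) ⊆ M ∧ B (k + 1) ⊆ M) := fun hg hgS hor =>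
        (hor.elim (h.ne_A_succ hg hgS) (h.ne_B_succ hg hgS)).elim
      by_cases hgS : g = S k
      · subst hgS
        have hsub : A (k + 1) ⊆ M ∧ B (k + 1) ⊆ M :=
          ⟨(h.A_sub k).trans hgM, (h.B_sub k).trans hgM⟩
        have hq' := h.isCl_succ hq hne.symm
        rcases h.canAdj_child hgq.symm with hc | hc
        · exact ⟨_, q, h.isCl_A _, hsub.1, hq', hI, hc.symm, fun _ => hsub⟩
        · exact ⟨_, q, h.isCl_B _, hsub.2, hq', hI, hc.symm, fun _ => hsub⟩
      have hg' := h.isCl_succ hg hgS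
      by_cases hqS : q = S k
      · subst hqS
        by_cases hgAB : g = A k ∨ g = B k
        · obtain ⟨hAM, hBM⟩ := hAB hgAB
          have hAS : A k ≠ S k := fun he => hmort hAM (he ▸ hI)
          have hBS : B k ≠ S k := fun he => hmort hBM (he ▸ hI)
          rcases h.immortal_split hI with hI' | hI'
          · obtain ⟨x, hx⟩ := h.nonempty (h.isCl_A (k + 1))
            exact ⟨A k, A (k + 1), h.isCl_succ (h.isCl_A k) hAS, hAM, h.isCl_A _, hI',
              (CanAdj.of_sees hx (h.A_sees k x hx)).symm, vac (h.isCl_A k) hAS⟩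
          · obtain ⟨x, hx⟩ := h.nonempty (h.isCl_B (k + 1))
            exact ⟨B k, B (k + 1), h.isCl_succ (h.isCl_B k) hBS, hBM, h.isCl_B _, hI',
              (CanAdj.of_sees hx (h.B_sees k x hx)).symm, vac (h.isCl_B k) hBS⟩
        · push Not at hgAB
          rcases h.immortal_split hI with hI' | hI'
          · exact ⟨g, _, hg', hgM, h.isCl_A _, hI',
              h.canAdj_A (by omega) hg hgAB.1 hgAB.2 hgq, vac hg hgS⟩
          · exact ⟨g, _, hg', hgM, h.isCl_B _, hI',
              h.canAdj_B (by omega) hg hgAB.1 hgAB.2 hgq, vac hg hgS⟩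
      · exact ⟨g, q, hg', hgM, h.isCl_succ hq hqS, hI, hgq, vac hg hgS⟩
  have hM' := hM
  simp only [Immortal, not_forall, not_exists, not_and] at hM'
  obtain ⟨N, hN⟩ := hM'
  obtain ⟨g, q, hg, hgM, hq, hI, hgq, hAB⟩ := key (N + n + 1) (by omega)
  have hnot : ¬ (g = A (N + n + 1) ∨ g = B (N + n + 1)) := fun hor => by
    refine hN (N + n) (by omega) ?_
    rw [h.split]
    exact Set.union_subset (hAB hor).1 (hAB hor).2
  push Not at hnot
  refine h.not_canAdj_immortal hfin (by omega) hg ?_ hnot.1 hnot.2 hq hI hgq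
  rintro m hm rfl
  exact hN m (by omega) hgM

lemma eq_of_canAdj_immortal (h : Evolution G cl S C A B) (hfin : ∀ x, (G.neighborSet x).Finite)
    {n : ℕ} (hn : 1 ≤ n) {f q : Set V} (hf : IsCl cl n f) (hm : ¬ Immortal S f)
    (hq : IsCl cl n q) (hI : Immortal S q) (hfq : CanAdj G f q) :
    (f = A n ∧ Immortal S (B n)) ∨ (f = B n ∧ Immortal S (A n)) := by
  obtain ⟨n, rfl⟩ : ∃ n', n = n' + 1 := ⟨n - 1, by omega⟩
  by_contra! hcon
  by_cases hfAB : f = A (n + 1) ∨ f = B (n + 1)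
  · have hmA : ¬ Immortal S (A (n + 1)) := by
      rcases hfAB with rfl | rfl
      exacts [hm, hcon.2 rfl]
    have hmB : ¬ Immortal S (B (n + 1)) := by
      rcases hfAB with rfl | rfl
      exacts [hcon.1 rfl, hm]
    refine h.not_canAdj_region hfin hn (M := S n) (fun hI => ?_) hf ?_ hq hI hfq
      fun _ => ⟨h.A_sub n, h.B_sub n⟩
    · exact (h.immortal_split hI).elim hmA hmB
    · rcases hfAB with rfl | rfl
      exacts [h.A_sub n, h.B_sub n]
  · exact h.not_canAdj_region hfin hn hm hf subset_rfl hq hI hfq fun hor => (hfAB hor).elim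

lemma immortal_A_or_B (h : Evolution G cl S C A B) (hG : G.Connected)
    (hfin : ∀ x, (G.neighborSet x).Finite) (hcl : ∀ n, {E | IsCl cl n E}.Finite) {n₀ n : ℕ}
    {f : Set V} (hf : IsCl cl n₀ f) (hm : ¬ Immortal S f) (hn : 1 ≤ n) (hnn : n₀ ≤ n) :
    (¬ Immortal S (A n) ∧ Immortal S (B n)) ∨ (¬ Immortal S (B n) ∧ Immortal S (A n)) := by
  obtain ⟨x, hx⟩ := h.nonempty hf
  have hxm : ¬ Immortal S (cl n x) := fun hI => hm (hI.mono
    (h.sub_of_meet hnn (h.isCl_cl n x) hf (h.mem_self n x) hx))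
  obtain ⟨q, hq, hqI⟩ := h.exists_immortal hcl n
  obtain ⟨y, hy⟩ := h.nonempty hq
  obtain ⟨p⟩ := hG.preconnected x y
  obtain ⟨e, _, he₁, he₂⟩ := p.exists_boundary_dart {z | ¬ Immortal S (cl n z)} hxm
    (fun hc => hc (h.eq_cl hq hy ▸ hqI))
  have he₂' : Immortal S (cl n e.snd) := not_not.1 he₂
  rcases h.eq_of_canAdj_immortal hfin hn (h.isCl_cl n e.fst) he₁ (h.isCl_cl n e.snd) he₂'
    ⟨_, h.mem_self _ _, _, h.mem_self _ _, e.adj⟩ with ⟨h1, h2⟩ | ⟨h1, h2⟩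
  · exact Or.inl ⟨h1 ▸ he₁, h2⟩
  · exact Or.inr ⟨h1 ▸ he₁, h2⟩

/-- If `A k` is mortal and `B k` is immortal for all large `k`, no class is branching. -/
lemma not_isBranching_of_mortal_A (h : Evolution G cl S C A B)
    (hfin : ∀ x, (G.neighborSet x).Finite) {k₀ : ℕ} (hk₀ : 1 ≤ k₀)
    (hA : ∀ k, k₀ ≤ k → ¬ Immortal S (A k)) (hB : ∀ k, k₀ ≤ k → Immortal S (B k)) {n : ℕ}
    {D E : Set V} (hD : IsBranching G cl S C A B n D E)
    (hDk : k₀ ≤ n ∨ Immortal S D) : False := by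
  have hS : ∀ k, k₀ ≤ k → Immortal S (S k) := fun k hk => (hB (k + 1) (by omega)).mono (h.B_sub k)
  have hAS : ∀ k, k₀ ≤ k → A k ≠ S k := fun k hk he => hA k hk (he ▸ hS k hk)
  have star : ∀ k, k₀ ≤ k → ∀ q, IsCl cl k q → q ≠ A k → q ≠ B k → q ≠ C k → q ≠ S k →
      CanAdj G q (S k) → False := by
    intro k hk q hq qA qB qC qS hadj
    by_cases hI : Immortal S q
    · have hqA := h.canAdj_A (by omega) hq qA qB hadj
      have hq2 := h.isCl_succ (h.isCl_succ hq qS) (h.S_succ_ne hq qC).symm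
      have hAS' := hAS (k + 1) (by omega)
      have hA2 := h.isCl_succ (h.isCl_A (k + 1)) hAS'
      rcases h.eq_of_canAdj_immortal hfin (by omega) hA2 (hA _ (by omega)) hq2 hI hqA.symm with
        ⟨he, _⟩ | ⟨he, _⟩
      · exact h.ne_A_succ (h.isCl_A _) hAS' he
      · exact h.ne_B_succ (h.isCl_A _) hAS' he
    · rcases h.eq_of_canAdj_immortal hfin (by omega) hq hI (h.isCl_S k) (hS k hk) hadj with
        ⟨he, _⟩ | ⟨he, _⟩
      exacts [qA he, qB he]
  by_cases hn : k₀ ≤ n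
  · exact star n hn D hD.isCl hD.ne_A hD.ne_B hD.ne_C hD.ne_S hD.adj_S
  obtain ⟨k, hk, hkD⟩ := hDk.resolve_left hn (k₀ + n + 1)
  obtain ⟨x, hx⟩ := h.nonempty (h.isCl_B (k + 1))
  have hxS := h.B_sub k hx
  have h3 := h.three_le_count_of_branching hfin hD (hkD hxS)
  have h3' := h.count_mono hfin (show n + 1 ≤ k by omega) x
  have hsub : nbrClasses G cl k x ⊆ {B k, C k} := by
    rintro F ⟨hF, hxF, hs⟩
    by_contra! hcon
    simp only [Set.mem_insert_iff, Set.mem_singleton_iff, not_or] at hcon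
    have hFS : F ≠ S k := by
      rintro rfl
      exact hxF hxS
    refine star k (by omega) F hF ?_ hcon.1 hcon.2 hFS (CanAdj.of_sees hxS hs).symm
    rintro rfl
    rcases h.eq_of_canAdj_immortal hfin (by omega) (h.isCl_succ hF hFS) (hA k (by omega))
      (h.isCl_B (k + 1)) (hB _ (by omega)) (CanAdj.of_sees hx hs).symm with ⟨he, _⟩ | ⟨he, _⟩
    · exact h.ne_A_succ hF hFS he
    · exact h.ne_B_succ hF hFS he
  have h2 : nbrClassCount G cl k x ≤ 2 :=
    (Set.ncard_le_ncard hsub (Set.toFinite _)).trans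
      ((Set.ncard_insert_le _ _).trans (by rw [Set.ncard_singleton]))
  omega

lemma mortal_A_succ (h : Evolution G cl S C A B) (hfin : ∀ x, (G.neighborSet x).Finite) {k : ℕ}
    (hA : ¬ Immortal S (A k))
    (hAB : (¬ Immortal S (A (k + 1)) ∧ Immortal S (B (k + 1))) ∨
      (¬ Immortal S (B (k + 1)) ∧ Immortal S (A (k + 1)))) :
    ¬ Immortal S (A (k + 1)) ∧ Immortal S (B (k + 1)) := by
  refine hAB.resolve_right fun ⟨_, hI⟩ => ?_
  have hAS : A k ≠ S k := fun he => hA (he ▸ hI.mono (h.A_sub k))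
  obtain ⟨x, hx⟩ := h.nonempty (h.isCl_A (k + 1))
  rcases h.eq_of_canAdj_immortal hfin (by omega) (h.isCl_succ (h.isCl_A k) hAS) hA (h.isCl_A _) hI
    (CanAdj.of_sees hx (h.A_sees k x hx)).symm with ⟨he, _⟩ | ⟨he, _⟩
  · exact h.ne_A_succ (h.isCl_A k) hAS he
  · exact h.ne_B_succ (h.isCl_A k) hAS he

/-- If some class is mortal, no class is branching. -/
lemma not_isBranching_of_mortal (h : Evolution G cl S C A B) (hG : G.Connected)
    (hfin : ∀ x, (G.neighborSet x).Finite) (hcl : ∀ n, {E | IsCl cl n E}.Finite) {n₀ : ℕ}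
    {f : Set V} (hf : IsCl cl n₀ f) (hm : ¬ Immortal S f) {n : ℕ} {D E : Set V}
    (hD : IsBranching G cl S C A B n D E) : False := by
  obtain ⟨k₀, hk₀, hDk, hAB⟩ : ∃ k₀, 1 ≤ k₀ ∧ (k₀ ≤ n ∨ Immortal S D) ∧ ∀ k, k₀ ≤ k →
      (¬ Immortal S (A k) ∧ Immortal S (B k)) ∨ (¬ Immortal S (B k) ∧ Immortal S (A k)) := by
    by_cases hI : Immortal S D
    · exact ⟨n₀ + 1, by omega, Or.inr hI, fun k hk =>
        h.immortal_A_or_B hG hfin hcl hf hm (by omega) (by omega)⟩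
    · exact ⟨n, hD.one_le, Or.inl le_rfl, fun k hk =>
        h.immortal_A_or_B hG hfin hcl hD.isCl hI (hD.one_le.trans hk) hk⟩
  rcases hAB k₀ le_rfl with hb | hb
  · have key : ∀ k, k₀ ≤ k → ¬ Immortal S (A k) ∧ Immortal S (B k) := fun k hk => by
      induction k, hk using Nat.le_induction with
      | base => exact hb
      | succ k hk ih => exact h.mortal_A_succ hfin ih.1 (hAB _ (by omega))
    exact h.not_isBranching_of_mortal_A hfin hk₀ (fun k hk => (key k hk).1)
      (fun k hk => (key k hk).2) hD hDk
  · have key : ∀ k, k₀ ≤ k → ¬ Immortal S (B k) ∧ Immortal S (A k) := fun k hk => by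
      induction k, hk using Nat.le_induction with
      | base => exact hb
      | succ k hk ih => exact h.swap.mortal_A_succ hfin ih.1 (hAB _ (by omega)).symm
    exact h.swap.not_isBranching_of_mortal_A hfin hk₀ (fun k hk => (key k hk).1)
      (fun k hk => (key k hk).2) hD.swap hDk

end Evolution

/-- `Z` is a class of level `n` all of whose points have `R` neighboring classes at all levels
from `n - 1` on. -/
structure IsMature (G : SimpleGraph V) (cl : ℕ → V → Set V) (R n : ℕ) (Z : Set V) : Prop where
  isCl : IsCl cl n Z
  count_eq : ∀ z ∈ Z, ∀ k, n ≤ k + 1 → nbrClassCount G cl k z = R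

lemma IsMature.mono {cl : ℕ → V → Set V} {R m n : ℕ} {Z Z' : Set V} (hZ : IsMature G cl R n Z)
    (hnm : n ≤ m) (hZ' : IsCl cl m Z') (hsub : Z' ⊆ Z) : IsMature G cl R m Z' :=
  ⟨hZ', fun z hz k hk => hZ.count_eq z (hsub hz) k (by omega)⟩

namespace Evolution

variable {cl : ℕ → V → Set V} {S C A B : ℕ → Set V} {R : ℕ}

lemma not_sees_both (h : Evolution G cl S C A B) (hfin : ∀ x, (G.neighborSet x).Finite)
    {n k : ℕ} {Z : Set V} (hZ : IsMature G cl R n Z) {z : V} (hz : z ∈ Z) (hk : n ≤ k + 1)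
    (hzS : z ∉ S k) (hA : Sees G z (A (k + 1))) (hB : Sees G z (B (k + 1))) : False := by
  have := h.count_lt_of_sees hfin hzS hA hB
  rw [hZ.count_eq z hz k hk, hZ.count_eq z hz (k + 1) (by omega)] at this
  exact lt_irrefl _ this

lemma not_sees_sibling (h : Evolution G cl S C A B)
    (hfin : ∀ x, (G.neighborSet x).Finite) {n k : ℕ} {Z : Set V} (hZ : IsMature G cl R n Z)
    {z : V} (hz : z ∈ Z) (hk : n ≤ k + 1) (hA : z ∈ A (k + 1)) (hB : Sees G z (B (k + 1))) :
    False := by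
  have := h.count_lt_of_mem hfin hA hB
  rw [hZ.count_eq z hz k hk, hZ.count_eq z hz (k + 1) (by omega)] at this
  exact lt_irrefl _ this

lemma eq_of_canAdj_S (h : Evolution G cl S C A B)
    (hfin : ∀ x, (G.neighborSet x).Finite) {n : ℕ} {Z : Set V} (hZ : IsMature G cl R n Z)
    (hn : 1 ≤ n) (hA : Z ≠ A n) (hB : Z ≠ B n) (hS : Z ≠ S n) (hadj : CanAdj G Z (S n)) :
    C n = Z := by
  by_contra hC
  obtain ⟨z, hz⟩ := h.nonempty hZ.isCl
  exact h.not_sees_both hfin hZ hz (by omega)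
    (fun hz' => hS (h.eq_of_meet hZ.isCl (h.isCl_S n) hz hz'))
    (h.sees_child hZ.isCl hS (Ne.symm hC) (h.isCl_A _)
      (h.canAdj_A hn hZ.isCl hA hB hadj) z hz)
    (h.sees_child hZ.isCl hS (Ne.symm hC) (h.isCl_B _)
      (h.canAdj_B hn hZ.isCl hA hB hadj) z hz)

lemma S_ne_A_of_isMature (h : Evolution G cl S C A B) (hfin : ∀ x, (G.neighborSet x).Finite)
    {m : ℕ} (hm : 1 ≤ m) (hS : IsMature G cl R m (S m)) : S m ≠ A m := by
  obtain ⟨m, rfl⟩ : ∃ m', m = m' + 1 := ⟨m - 1, by omega⟩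
  intro he
  obtain ⟨z, hz⟩ := h.nonempty (h.isCl_B (m + 2))
  have hzS := h.B_sub (m + 1) hz
  exact h.not_sees_sibling hfin hS hzS le_rfl (he ▸ hzS) (h.B_sees _ z hz)

lemma S_ne_B_of_isMature (h : Evolution G cl S C A B) (hfin : ∀ x, (G.neighborSet x).Finite)
    {m : ℕ} (hm : 1 ≤ m) (hS : IsMature G cl R m (S m)) : S m ≠ B m :=
  h.swap.S_ne_A_of_isMature hfin hm hS

lemma not_sees_B_of_isMature (h : Evolution G cl S C A B) (hfin : ∀ x, (G.neighborSet x).Finite)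
    {m : ℕ} (hm : 1 ≤ m) (hS : IsMature G cl R m (S m)) {z : V} (hz : z ∈ A (m + 1)) :
    ¬ Sees G z (B m) := by
  intro hs
  have hA := h.S_ne_A_of_isMature hfin hm hS
  have hB := h.S_ne_B_of_isMature hfin hm hS
  obtain ⟨m, rfl⟩ : ∃ m', m = m' + 1 := ⟨m - 1, by omega⟩
  have hzS := h.A_sub (m + 1) hz
  refine h.not_sees_both hfin hS hzS le_rfl (fun hz' => ?_) (h.A_sees _ z hz) hs
  rw [h.split m] at hz'
  exact hz'.elim (fun hz' => hA (h.eq_of_meet (h.isCl_S _) (h.isCl_A _) hzS hz'))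
    (fun hz' => hB (h.eq_of_meet (h.isCl_S _) (h.isCl_B _) hzS hz'))

lemma C_ne_S_of_isMature (h : Evolution G cl S C A B) (hfin : ∀ x, (G.neighborSet x).Finite)
    {m : ℕ} (hS : IsMature G cl R m (S m)) : C m ≠ S m := by
  intro he
  have hsub : S (m + 1) ⊆ S m := he ▸ h.S_sub_C m
  have hS' := hS.mono (Nat.le_succ m) (h.isCl_S _) hsub
  exact (h.S_succ_of_eq he).elim (h.S_ne_A_of_isMature hfin (by omega) hS')
    (h.S_ne_B_of_isMature hfin (by omega) hS')

lemma C_ne_A_of_isMature (h : Evolution G cl S C A B) (hfin : ∀ x, (G.neighborSet x).Finite)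
    {m : ℕ} (hm : 1 ≤ m) (hS : IsMature G cl R m (S m)) : C m ≠ A m := by
  intro he
  have hS' := h.S_succ_of_ne (h.C_ne_S_of_isMature hfin hS)
  obtain ⟨z, hz⟩ := h.nonempty (h.isCl_B (m + 2))
  obtain ⟨y, hzy, hy⟩ := h.B_sees _ z hz
  have hzA := h.B_sub _ hz
  rw [hS', he] at hzA
  exact h.swap.not_sees_B_of_isMature hfin hm hS hy ⟨z, hzy.symm, hzA⟩

lemma exists_canAdj_S_of_isMature (h : Evolution G cl S C A B)
    (hfin : ∀ x, (G.neighborSet x).Finite) (hR : 3 ≤ R) {m : ℕ} (hm : 1 ≤ m)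
    (hS : IsMature G cl R m (S m)) :
    ∃ Y, IsCl cl m Y ∧ Y ≠ S m ∧ Y ≠ A m ∧ Y ≠ B m ∧ Y ≠ C m ∧ CanAdj G Y (S m) := by
  obtain ⟨z, hz⟩ := h.nonempty (h.isCl_A (m + 1))
  have hzS := h.A_sub m hz
  by_contra! hcon
  have hsub : nbrClasses G cl m z ⊆ {A m, C m} := by
    rintro Y ⟨hY, hzY, hs⟩
    by_contra! hY'
    simp only [Set.mem_insert_iff, Set.mem_singleton_iff, not_or] at hY'
    refine hcon Y hY ?_ hY'.1 ?_ hY'.2 (CanAdj.of_sees hzS hs).symm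
    · rintro rfl
      exact hzY hzS
    · rintro rfl
      exact h.not_sees_B_of_isMature hfin hm hS hz hs
  have h2 : nbrClassCount G cl m z ≤ 2 := (Set.ncard_le_ncard hsub (Set.toFinite _)).trans
    ((Set.ncard_insert_le _ _).trans (by rw [Set.ncard_singleton]))
  have := hS.count_eq z hzS m (by omega)
  omega

/-- As long as `W` is not split, a mature neighbor of `W` contains a mature neighbor of `W`. -/
lemma exists_isMature_sub (h : Evolution G cl S C A B) {n k : ℕ} (hnk : n ≤ k) {W Z : Set V}
    (hZ : IsMature G cl R n Z) (hZW : CanAdj G W Z) :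
    ∃ Z', Z' ⊆ Z ∧ IsMature G cl R k Z' ∧ CanAdj G W Z' := by
  obtain ⟨x, hx, y, hy, hxy⟩ := hZW
  have hsub := h.sub_of_meet hnk (h.isCl_cl k y) hZ.isCl (h.mem_self k y) hy
  exact ⟨cl k y, hsub, hZ.mono hnk (h.isCl_cl k y) hsub, x, hx, y, h.mem_self k y, hxy⟩

lemma two_isMature_false (h : Evolution G cl S C A B) (hfin : ∀ x, (G.neighborSet x).Finite)
    {k : ℕ} {W Z₁ Z₂ : Set V} (hWS : S (k + 1) = W) (h₁ : IsMature G cl R k Z₁)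
    (h₂ : IsMature G cl R k Z₂) (hne : Z₁ ≠ Z₂) (h₁W : Z₁ ≠ W) (h₂W : Z₂ ≠ W)
    (h₁S : Z₁ ≠ S k) (h₂S : Z₂ ≠ S k) (a₁ : CanAdj G W Z₁) (a₂ : CanAdj G W Z₂) : False := by
  subst hWS
  have key : ∀ {Z}, IsMature G cl R k Z → Z ≠ S (k + 1) → Z ≠ S k → CanAdj G (S (k + 1)) Z →
      C (k + 1) = Z := fun hZ hZW hZS hadj =>
    h.eq_of_canAdj_S hfin
      (hZ.mono (Nat.le_succ k) (h.isCl_succ hZ.isCl hZS) subset_rfl) (by omega)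
      (h.ne_A_succ hZ.isCl hZS) (h.ne_B_succ hZ.isCl hZS) hZW hadj.symm
  exact hne ((key h₁ h₁W h₁S a₁).symm.trans (key h₂ h₂W h₂S a₂))

/-- A class has at most two mature neighbors. -/
lemma three_isMature_false (h : Evolution G cl S C A B) (hfin : ∀ x, (G.neighborSet x).Finite)
    (hI : ∀ n E, IsCl cl n E → Immortal S E) {n : ℕ} {W Z₁ Z₂ Z₃ : Set V} (hW : IsCl cl n W)
    (hWS : W ≠ S n) (h₁ : IsMature G cl R n Z₁) (h₂ : IsMature G cl R n Z₂)
    (h₃ : IsMature G cl R n Z₃) (h₁₂ : Z₁ ≠ Z₂) (h₁₃ : Z₁ ≠ Z₃) (h₂₃ : Z₂ ≠ Z₃) (h₁W : Z₁ ≠ W)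
    (h₂W : Z₂ ≠ W) (h₃W : Z₃ ≠ W) (a₁ : CanAdj G W Z₁) (a₂ : CanAdj G W Z₂)
    (a₃ : CanAdj G W Z₃) : False := by
  obtain ⟨l, hl, hlW, hfirst⟩ := exists_first_visit (fun l => S l = W)
    (h.exists_visit hW (hI n W hW))
  have hnl : n ≠ l := by
    rintro rfl
    exact hWS hlW.symm
  obtain ⟨k, rfl⟩ : ∃ k, l = k + 1 := ⟨l - 1, by omega⟩
  have hnk : n ≤ k := by omega
  obtain ⟨Y₁, s₁, m₁, b₁⟩ := h.exists_isMature_sub hnk h₁ a₁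
  obtain ⟨Y₂, s₂, m₂, b₂⟩ := h.exists_isMature_sub hnk h₂ a₂
  obtain ⟨Y₃, s₃, m₃, b₃⟩ := h.exists_isMature_sub hnk h₃ a₃
  have hne : ∀ {Z Z' Y Y'}, IsMature G cl R n Z → IsMature G cl R n Z' → IsMature G cl R k Y →
      Y ⊆ Z → Y' ⊆ Z' → Z ≠ Z' → Y ≠ Y' := by
    rintro Z Z' Y _ hZ hZ' hY hs hs' hZZ rfl
    exact hZZ (h.eq_of_sub hZ.isCl hZ'.isCl (h.nonempty hY.isCl) hs hs')
  have hneW : ∀ {Z Y}, IsMature G cl R n Z → IsMature G cl R k Y → Y ⊆ Z → Z ≠ W → Y ≠ W := by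
    rintro Z _ hZ hY hs hZW rfl
    exact hZW (h.eq_of_sub hZ.isCl hW (h.nonempty hY.isCl) hs subset_rfl)
  have n₁₂ := hne h₁ h₂ m₁ s₁ s₂ h₁₂
  have n₁₃ := hne h₁ h₃ m₁ s₁ s₃ h₁₃
  have n₂₃ := hne h₂ h₃ m₂ s₂ s₃ h₂₃
  have w₁ := hneW h₁ m₁ s₁ h₁W
  have w₂ := hneW h₂ m₂ s₂ h₂W
  have w₃ := hneW h₃ m₃ s₃ h₃W
  by_cases e₁ : Y₁ = S k
  · exact h.two_isMature_false hfin hlW m₂ m₃ n₂₃ w₂ w₃ (e₁ ▸ n₁₂.symm) (e₁ ▸ n₁₃.symm) b₂ b₃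
  by_cases e₂ : Y₂ = S k
  · exact h.two_isMature_false hfin hlW m₁ m₃ n₁₃ w₁ w₃ e₁ (e₂ ▸ n₂₃.symm) b₁ b₃
  · exact h.two_isMature_false hfin hlW m₁ m₂ n₁₂ w₁ w₂ e₁ e₂ b₁ b₂

/-- A class with two mature neighbors is not split before one of them is. -/
lemma exists_visit_lt (h : Evolution G cl S C A B) (hfin : ∀ x, (G.neighborSet x).Finite)
    {n l : ℕ} (hnl : n ≤ l) {W Z₁ Z₂ : Set V} (hWS : W ≠ S n)
    (h₁ : IsMature G cl R n Z₁) (h₂ : IsMature G cl R n Z₂) (h₁₂ : Z₁ ≠ Z₂) (h₁W : Z₁ ≠ W)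
    (h₂W : Z₂ ≠ W) (a₁ : CanAdj G W Z₁) (a₂ : CanAdj G W Z₂) (hl : S l = W) :
    ∃ k, n ≤ k ∧ k < l ∧ (S k = Z₁ ∨ S k = Z₂) := by
  by_contra! hcon
  have hn : n ≠ l := by
    rintro rfl
    exact hWS hl.symm
  obtain ⟨k, rfl⟩ : ∃ k, l = k + 1 := ⟨l - 1, by omega⟩
  have hnk : n ≤ k := by omega
  exact h.two_isMature_false hfin hl
    (h₁.mono hnk (h.persist hnk h₁.isCl fun i hi hik => (hcon i hi (by omega)).1) subset_rfl)
    (h₂.mono hnk (h.persist hnk h₂.isCl fun i hi hik => (hcon i hi (by omega)).2) subset_rfl)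
    h₁₂ h₁W h₂W (hcon k hnk (by omega)).1.symm (hcon k hnk (by omega)).2.symm a₁ a₂

lemma C_eq_of_two_isMature (h : Evolution G cl S C A B) (hfin : ∀ x, (G.neighborSet x).Finite)
    (hI : ∀ n E, IsCl cl n E → Immortal S E) {j : ℕ} (hj : 1 ≤ j) {W Z : Set V}
    (hS : IsMature G cl R j (S j)) (hW : IsCl cl j W) (hWS : W ≠ S j) (hWA : W ≠ A j)
    (hWB : W ≠ B j) (hZ : IsMature G cl R j Z) (hZS : Z ≠ S j) (hZW : Z ≠ W)
    (a : CanAdj G W (S j)) (a' : CanAdj G W Z) : C j = W := by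
  by_contra hC
  exact h.three_isMature_false hfin hI (h.isCl_succ hW hWS) (h.S_succ_ne hW (Ne.symm hC)).symm
    (hS.mono (Nat.le_succ j) (h.isCl_A _) (h.A_sub j))
    (hS.mono (Nat.le_succ j) (h.isCl_B _) (h.B_sub j))
    (hZ.mono (Nat.le_succ j) (h.isCl_succ hZ.isCl hZS) subset_rfl)
    (h.A_ne_B j) (h.ne_A_succ hZ.isCl hZS).symm (h.ne_B_succ hZ.isCl hZS).symm
    (h.ne_A_succ hW hWS).symm (h.ne_B_succ hW hWS).symm hZW
    (h.canAdj_A hj hW hWA hWB a) (h.canAdj_B hj hW hWA hWB a) a'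

lemma C_eq_of_first_visit (h : Evolution G cl S C A B) (hfin : ∀ x, (G.neighborSet x).Finite)
    (hI : ∀ n E, IsCl cl n E → Immortal S E) {n j : ℕ} (hn : 1 ≤ n) (hnj : n ≤ j) {W Z Z' : Set V}
    (hZ : IsMature G cl R n Z) (hZ' : IsMature G cl R n Z') (hZZ : Z' ≠ Z) (hW : IsCl cl n W)
    (hWS : W ≠ S n) (hWA : W ≠ A n) (hWB : W ≠ B n) (hZW : Z ≠ W) (hZW' : Z' ≠ W)
    (a : CanAdj G W Z) (a' : CanAdj G W Z') (hj : S j = Z)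
    (hfirst : ∀ k, n ≤ k → k < j → S k ≠ Z ∧ S k ≠ Z') : C j = W ∧ IsCl cl j W := by
  have hWk : ∀ k, n ≤ k → k < j → S k ≠ W := by
    intro k hk hkj hkW
    obtain ⟨i, hi, hik, hor⟩ := h.exists_visit_lt hfin hk hWS hZ hZ' hZZ.symm hZW hZW' a a' hkW
    exact hor.elim (hfirst i hi (by omega)).1 (hfirst i hi (by omega)).2
  have hWj := h.persist hnj hW hWk
  have hWA' : W ≠ A j := by
    rcases hnj.eq_or_lt with rfl | hlt
    exacts [hWA, h.ne_A_of_persist hlt hW hWk]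
  have hWB' : W ≠ B j := by
    rcases hnj.eq_or_lt with rfl | hlt
    exacts [hWB, h.ne_B_of_persist hlt hW hWk]
  subst hj
  exact ⟨h.C_eq_of_two_isMature hfin hI (by omega) (hZ.mono hnj (h.isCl_S j) subset_rfl) hWj
    hZW.symm hWA' hWB' (hZ'.mono hnj
      (h.persist hnj hZ'.isCl fun k hk hkj => (hfirst k hk hkj).2) subset_rfl) hZZ hZW' a a', hWj⟩

/-- A mature class with two neighbors `W₁`, `W₂`, each having another mature neighbor, is not
split before one of these mature neighbors is. -/
lemma first_visit_false (h : Evolution G cl S C A B) (hfin : ∀ x, (G.neighborSet x).Finite)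
    (hI : ∀ n E, IsCl cl n E → Immortal S E) {n j : ℕ} (hn : 1 ≤ n) (hnj : n ≤ j)
    {Z Z₁ Z₂ W₁ W₂ : Set V} (hZ : IsMature G cl R n Z) (hZ₁ : IsMature G cl R n Z₁)
    (hZ₂ : IsMature G cl R n Z₂) (hne₁ : Z₁ ≠ Z) (hne₂ : Z₂ ≠ Z)
    (hW₁ : IsCl cl n W₁) (hW₂ : IsCl cl n W₂) (hW : W₁ ≠ W₂)
    (hS₁ : W₁ ≠ S n) (hA₁ : W₁ ≠ A n) (hB₁ : W₁ ≠ B n)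
    (hS₂ : W₂ ≠ S n) (hA₂ : W₂ ≠ A n) (hB₂ : W₂ ≠ B n)
    (hZW₁ : Z ≠ W₁) (hZW₂ : Z ≠ W₂) (hZW₁' : Z₁ ≠ W₁) (hZW₂' : Z₂ ≠ W₂)
    (a₁ : CanAdj G W₁ Z) (a₂ : CanAdj G W₂ Z) (a₁' : CanAdj G W₁ Z₁) (a₂' : CanAdj G W₂ Z₂)
    (hfirst : ∀ k, n ≤ k → k < j → S k ≠ Z ∧ S k ≠ Z₁ ∧ S k ≠ Z₂) : S j ≠ Z := fun hj =>
  hW ((h.C_eq_of_first_visit hfin hI hn hnj hZ hZ₁ hne₁ hW₁ hS₁ hA₁ hB₁ hZW₁ hZW₁' a₁ a₁' hj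
      fun k hk hkj => ⟨(hfirst k hk hkj).1, (hfirst k hk hkj).2.1⟩).1.symm.trans
    (h.C_eq_of_first_visit hfin hI hn hnj hZ hZ₂ hne₂ hW₂ hS₂ hA₂ hB₂ hZW₂ hZW₂' a₂ a₂' hj
      fun k hk hkj => ⟨(hfirst k hk hkj).1, (hfirst k hk hkj).2.2⟩).1)

end Evolution

namespace Evolution

variable {cl : ℕ → V → Set V} {S C A B : ℕ → Set V} {R : ℕ}

lemma exists_two_isMature_S (h : Evolution G cl S C A B) (hfin : ∀ x, (G.neighborSet x).Finite)
    (hI : ∀ n E, IsCl cl n E → Immortal S E) {p i : ℕ} (hp : 1 ≤ p) (hpi : p ≤ i)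
    {D D' Y : Set V} (hD : IsMature G cl R p D) (hD' : IsMature G cl R p D') (hne : D' ≠ D)
    (hY : IsCl cl p Y) (hYS : Y ≠ S p) (hYA : Y ≠ A p) (hYB : Y ≠ B p) (hDY : D ≠ Y)
    (hDY' : D' ≠ Y) (a : CanAdj G Y D) (a' : CanAdj G Y D') (hi : S i = D)
    (hfirst : ∀ k, p ≤ k → k < i → S k ≠ D ∧ S k ≠ D') :
    IsMature G cl R i (S i) ∧ IsCl cl i D' ∧ D' ≠ S i ∧ S (i + 2) = D' ∧
      IsMature G cl R (i + 2) (S (i + 2)) := by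
  obtain ⟨hC, hYi⟩ := h.C_eq_of_first_visit hfin hI hp hpi hD hD' hne hY hYS hYA hYB hDY hDY'
    a a' hi hfirst
  have hDi' : IsCl cl i D' := h.persist hpi hD'.isCl fun k hk hki => (hfirst k hk hki).2
  subst hi
  have hS1 : S (i + 1) = Y := (h.S_succ_of_ne (hC.trans_ne hDY.symm)).trans hC
  have hm : IsMature G cl R (i + 1) D' := hD'.mono (by omega) (h.isCl_succ hDi' hne) subset_rfl
  have hDS : D' ≠ S (i + 1) := hS1 ▸ hDY'
  have hC1 : C (i + 1) = D' := h.eq_of_canAdj_S hfin hm (by omega) (h.ne_A_succ hDi' hne)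
    (h.ne_B_succ hDi' hne) hDS (hS1 ▸ a'.symm)
  have hS2 : S (i + 2) = D' := (h.S_succ_of_ne (hC1.trans_ne hDS)).trans hC1
  exact ⟨hD.mono hpi (h.isCl_S i) subset_rfl, hDi', hne, hS2,
    hm.mono (Nat.le_succ _) (h.isCl_S _) hS2.le⟩

lemma first_visit_A_false (h : Evolution G cl S C A B) (hfin : ∀ x, (G.neighborSet x).Finite)
    (hI : ∀ n E, IsCl cl n E → Immortal S E) (hR : 3 ≤ R) {i j : ℕ} (hi : 1 ≤ i)
    (hS : IsMature G cl R i (S i)) (hS₂ : IsMature G cl R (i + 2) (S (i + 2)))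
    (hSi : IsCl cl i (S (i + 2))) (hne : S (i + 2) ≠ S i) (hj : i + 3 ≤ j)
    (hfirst : ∀ k, i + 3 ≤ k → k < j →
      S k ≠ A (i + 1) ∧ S k ≠ B (i + 1) ∧ S k ≠ A (i + 3) ∧ S k ≠ B (i + 3)) :
    S j ≠ A (i + 1) ∧ S j ≠ A (i + 3) := by
  obtain ⟨Y, hY, YS, YA, YB, YC, aY⟩ := h.exists_canAdj_S_of_isMature hfin hR hi hS
  obtain ⟨X, hX, XS, XA, XB, XC, aX⟩ := h.exists_canAdj_S_of_isMature hfin hR (by omega) hS₂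
  have hCS := h.C_ne_S_of_isMature hfin hS
  have hS1 : S (i + 1) = C i := h.S_succ_of_ne hCS
  have hY1 := h.isCl_succ hY YS
  have hYS1 : Y ≠ S (i + 1) := hS1 ▸ YC
  have hY2 := h.isCl_succ hY1 hYS1
  have aYA := h.canAdj_A hi hY YA YB aY
  have aYB := h.canAdj_B hi hY YA YB aY
  have aXA := h.canAdj_A (by omega) hX XA XB aX
  have aXB := h.canAdj_B (by omega) hX XA XB aX
  have YneA := h.ne_A_succ hY YS
  have YneB := h.ne_B_succ hY YS
  -- The children of `S i` are not split at levels `i + 1` and `i + 2`.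
  have A1S1 : A (i + 1) ≠ S (i + 1) := hS1 ▸ (h.ne_A_succ (h.isCl_C i) hCS).symm
  have B1S1 : B (i + 1) ≠ S (i + 1) := hS1 ▸ (h.ne_B_succ (h.isCl_C i) hCS).symm
  have A1S2 : A (i + 1) ≠ S (i + 2) := (h.ne_A_succ hSi hne).symm
  have B1S2 : B (i + 1) ≠ S (i + 2) := (h.ne_B_succ hSi hne).symm
  have hA12 := h.isCl_succ (h.isCl_A (i + 1)) A1S1
  have hB12 := h.isCl_succ (h.isCl_B (i + 1)) B1S1
  have mA := hS.mono (Nat.le_succ i) (h.isCl_A _) (h.A_sub i)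
  have mB := hS.mono (Nat.le_succ i) (h.isCl_B _) (h.B_sub i)
  have mA3 := hS.mono (by omega) (h.isCl_succ hA12 A1S2) (h.A_sub i)
  have mB3 := hS.mono (by omega) (h.isCl_succ hB12 B1S2) (h.B_sub i)
  have nA3 := hS₂.mono (Nat.le_succ _) (h.isCl_A _) (h.A_sub (i + 2))
  have nB3 := hS₂.mono (Nat.le_succ _) (h.isCl_B _) (h.B_sub (i + 2))
  have hYS2 : Y ≠ S (i + 2) := fun he => by
    obtain ⟨k, hk, hki, hor⟩ := h.exists_visit_lt hfin (by omega : i + 1 ≤ i + 2) hYS1 mA mB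
      (h.A_ne_B i) YneA.symm YneB.symm aYA aYB he.symm
    obtain rfl : k = i + 1 := by omega
    exact hor.elim A1S1.symm B1S1.symm
  have hYS3 : Y ≠ S (i + 3) := fun he => by
    obtain ⟨k, hk, hki, hor⟩ := h.exists_visit_lt hfin (by omega : i + 1 ≤ i + 3) hYS1 mA mB
      (h.A_ne_B i) YneA.symm YneB.symm aYA aYB he.symm
    obtain rfl | rfl : k = i + 1 ∨ k = i + 2 := by omega
    · exact hor.elim A1S1.symm B1S1.symm
    · exact hor.elim A1S2.symm B1S2.symm
  have hY3 := h.isCl_succ hY2 hYS2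
  have A2S2 : A (i + 2) ≠ S (i + 2) := (h.S_ne_A_of_isMature hfin (by omega) hS₂).symm
  have hA23 := h.isCl_succ (h.isCl_A (i + 2)) A2S2
  have A2S3 : A (i + 2) ≠ S (i + 3) :=
    (h.S_succ_ne (h.isCl_A _) (h.C_ne_A_of_isMature hfin (by omega) hS₂).symm).symm
  have hX3 := h.isCl_succ hX XS
  have XS3 : X ≠ S (i + 3) := (h.S_succ_ne hX XC).symm
  have a21 : CanAdj G (A (i + 2)) (A (i + 1)) := by
    obtain ⟨x, hx⟩ := h.nonempty (h.isCl_A (i + 2))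
    exact CanAdj.of_sees hx (h.A_sees _ x hx)
  have a23 : CanAdj G (A (i + 2)) (A (i + 3)) := by
    obtain ⟨x, hx⟩ := h.nonempty (h.isCl_A (i + 3))
    exact (CanAdj.of_sees hx (h.A_sees _ x hx)).symm
  have A1A2 : A (i + 1) ≠ A (i + 2) := h.ne_A_succ (h.isCl_A _) A1S1
  have A1A3 : A (i + 1) ≠ A (i + 3) := h.ne_A_succ hA12 A1S2
  have A2A3 : A (i + 2) ≠ A (i + 3) := h.ne_A_succ (h.isCl_A _) A2S2
  have A2B3 : A (i + 2) ≠ B (i + 3) := h.ne_B_succ (h.isCl_A _) A2S2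
  constructor
  · exact h.first_visit_false hfin hI (by omega) hj mA3 nA3 mB3 A1A3.symm (h.A_ne_B i).symm
      hA23 hY3 (h.ne_A_succ hY1 hYS1).symm A2S3 A2A3 A2B3 hYS3 (h.ne_A_succ hY2 hYS2)
      (h.ne_B_succ hY2 hYS2) A1A2 YneA.symm A2A3.symm YneB.symm a21 aYA a23 aYB
      fun k hk hkj => ⟨(hfirst k hk hkj).1, (hfirst k hk hkj).2.2.1, (hfirst k hk hkj).2.1⟩
  · exact h.first_visit_false hfin hI (by omega) hj nA3 mA3 nB3 A1A3 (h.A_ne_B _).symm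
      hA23 hX3 XA.symm A2S3 A2A3 A2B3 XS3 (h.ne_A_succ hX XS)
      (h.ne_B_succ hX XS) A2A3.symm (h.ne_A_succ hX XS).symm A1A2 (h.ne_B_succ hX XS).symm
      a23 aXA a21 aXB
      fun k hk hkj => ⟨(hfirst k hk hkj).2.2.1, (hfirst k hk hkj).1, (hfirst k hk hkj).2.2.2⟩

/-- If all classes are immortal, there is no mature class with `R ≥ 3`. -/
lemma isMature_false (h : Evolution G cl S C A B) (hfin : ∀ x, (G.neighborSet x).Finite)
    (hI : ∀ n E, IsCl cl n E → Immortal S E) (hR : 3 ≤ R) {n : ℕ} (hn : 1 ≤ n) {X : Set V}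
    (hX : IsMature G cl R n X) : False := by
  obtain ⟨m, hnm, rfl⟩ := h.exists_visit hX.isCl (hI n X hX.isCl)
  have hS := hX.mono hnm (h.isCl_S m) subset_rfl
  obtain ⟨Y, hY, YS, YA, YB, YC, aY⟩ := h.exists_canAdj_S_of_isMature hfin hR (by omega) hS
  have aYA := h.canAdj_A (by omega) hY YA YB aY
  have aYB := h.canAdj_B (by omega) hY YA YB aY
  have mA := hS.mono (Nat.le_succ m) (h.isCl_A _) (h.A_sub m)
  have mB := hS.mono (Nat.le_succ m) (h.isCl_B _) (h.B_sub m)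
  have YneA := h.ne_A_succ hY YS
  have YneB := h.ne_B_succ hY YS
  have hYS1 : Y ≠ S (m + 1) := (h.S_succ_ne hY YC).symm
  have hY1 := h.isCl_succ hY YS
  obtain ⟨i, hi, hor, hfirst⟩ := exists_first_visit (n := m + 1)
    (fun i => S i = A (m + 1) ∨ S i = B (m + 1)) (by
      obtain ⟨i, hi, he⟩ := h.exists_visit (h.isCl_A (m + 1)) (hI _ _ (h.isCl_A _))
      exact ⟨i, hi, Or.inl he⟩)
  simp only [not_or] at hfirst
  obtain ⟨hSi, hD, hDS, hmS⟩ : IsMature G cl R i (S i) ∧ IsCl cl i (S (i + 2)) ∧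
      S (i + 2) ≠ S i ∧ IsMature G cl R (i + 2) (S (i + 2)) := by
    rcases hor with he | he
    · obtain ⟨h1, h2, h3, h4, h5⟩ := h.exists_two_isMature_S hfin hI (by omega) hi mA mB
        (h.A_ne_B m).symm hY1 hYS1 YneA YneB YneA.symm YneB.symm aYA aYB he hfirst
      exact ⟨h1, h4 ▸ h2, h4 ▸ h3, h5⟩
    · obtain ⟨h1, h2, h3, h4, h5⟩ := h.exists_two_isMature_S hfin hI (by omega) hi mB mA
        (h.A_ne_B m) hY1 hYS1 YneA YneB YneB.symm YneA.symm aYB aYA he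
        fun k hk hki => (hfirst k hk hki).symm
      exact ⟨h1, h4 ▸ h2, h4 ▸ h3, h5⟩
  obtain ⟨j, hj, hor', hfirst'⟩ := exists_first_visit (n := i + 3)
    (fun k => S k = A (i + 1) ∨ S k = B (i + 1) ∨ S k = A (i + 3) ∨ S k = B (i + 3)) (by
      obtain ⟨j, hj, he⟩ := h.exists_visit (h.isCl_A (i + 3)) (hI _ _ (h.isCl_A _))
      exact ⟨j, hj, Or.inr (Or.inr (Or.inl he))⟩)
  simp only [not_or] at hfirst'
  have h1 := h.first_visit_A_false hfin hI hR (by omega) hSi hmS hD hDS hj hfirst'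
  have h2 := h.swap.first_visit_A_false hfin hI hR (by omega) hSi hmS hD hDS hj
    fun k hk hkj => ⟨(hfirst' k hk hkj).2.1, (hfirst' k hk hkj).1, (hfirst' k hk hkj).2.2.2,
      (hfirst' k hk hkj).2.2.1⟩
  rcases hor' with he | he | he | he
  exacts [h1.1 he, h2.1 he, h1.2 he, h2.2 he]

/-- No class is branching. -/
lemma not_isBranching (h : Evolution G cl S C A B) (hG : G.Connected)
    (hfin : ∀ x, (G.neighborSet x).Finite) {d : ℕ} (hd : ∀ x, (G.neighborSet x).ncard ≤ d)
    (hcl : ∀ n, {E | IsCl cl n E}.Finite) {n : ℕ} {D E : Set V} :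
    ¬ IsBranching G cl S C A B n D E := by
  intro hD
  by_cases hI : ∀ n E, IsCl cl n E → Immortal S E
  · obtain ⟨x, hx⟩ := h.nonempty hD.isCl
    have h3 := h.three_le_count_of_branching hfin hD hx
    let T : Set ℕ := {r | ∃ k z, nbrClassCount G cl k z = r}
    have hT : BddAbove T := ⟨d, by
      rintro _ ⟨k, z, rfl⟩
      exact (h.count_le hfin k z).trans (hd z)⟩
    have hle : ∀ k z, nbrClassCount G cl k z ≤ sSup T := fun k z => le_csSup hT ⟨k, z, rfl⟩
    obtain ⟨k, z, hz⟩ := Nat.sSup_mem (s := T) ⟨_, 0, x, rfl⟩ hT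
    refine h.isMature_false hfin hI (h3.trans (hle _ x)) (Nat.le_add_left 1 k)
      (X := cl (k + 1) z) ⟨h.isCl_cl _ _, fun y hy l hl => le_antisymm (hle l y) ?_⟩
    rw [← hz, ← h.count_congr hy]
    exact h.count_mono hfin (by omega) y
  · push Not at hI
    obtain ⟨n₀, f, hf, hm⟩ := hI
    exact h.not_isBranching_of_mortal hG hfin hcl hf hm hD

end Evolution

lemma BallEquiv.color_eq {n : ℕ} {x y : V} (h : BallEquiv G φ n x y) : φ y = φ x := by
  obtain ⟨f, _, hφ, hxy⟩ := h
  exact (congrArg φ hxy).symm.trans (hφ _)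

lemma Labeling.eq_A_or_B_zero (L : Labeling G φ a b) (hSt : IsSturmian G φ) (hab : a ≠ b)
    {D : Set V} (hD : D ∈ ballClasses G φ 0) : D = L.A 0 ∨ D = L.B 0 := by
  obtain ⟨x, hx, hA⟩ := L.A0_col
  obtain ⟨y, hy, hB⟩ := L.B0_col
  have hne : L.A 0 ≠ L.B 0 := fun he => by
    rw [hA, hB, ballClass_eq_iff] at he
    exact hab (by rw [← hx, ← hy, he.color_eq])
  have hsub : {L.A 0, L.B 0} ⊆ ballClasses G φ 0 := by
    rintro _ (rfl | rfl)
    exacts [⟨x, hA⟩, ⟨y, hB⟩]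
  have heq := Set.eq_of_subset_of_ncard_le hsub (by rw [hSt 0, Set.ncard_pair hne])
    (hSt.finite 0)
  rw [← heq] at hD
  exact hD

end

/-- Lemma 2.4: (1) if `D` is distinct from `A_n, B_n, C_n, S_n` and is
adjacent to `S_n` in `G_n`, then `D` has degree 1 in `G_n` and `G_{n+1}` has a cycle;
(2) if `B_{n+1}` can be adjacent to `A_n` (resp. `A_{n+1}` to `B_n`) and
`A_n ≠ S_n, C_n` (resp. `B_n ≠ S_n, C_n`), then `G_{n+1}` has a cycle. -/
theorem merged_lemma {V α : Type} (G : SimpleGraph V) (d : ℕ) (hd : 3 ≤ d)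
    (hT : IsRegularTree G d) (φ : V → α) (hSt : IsSturmian G φ)
    (a b : α) (hab : a ≠ b) (L : Labeling G φ a b) (n : ℕ) :
    (∀ D ∈ ballClasses G φ n, D ≠ L.A n → D ≠ L.B n → D ≠ L.C n → D ≠ L.S n →
      CanAdj G (L.S n) D →
      (∃! E, E ∈ ballClasses G φ n ∧ E ≠ D ∧ CanAdj G D E) ∧ HasCycle G φ (n + 1)) ∧
    ((CanAdj G (L.B (n + 1)) (L.A n) → L.A n ≠ L.S n → L.A n ≠ L.C n →
        HasCycle G φ (n + 1)) ∧
     (CanAdj G (L.A (n + 1)) (L.B n) → L.B n ≠ L.S n → L.B n ≠ L.C n →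
        HasCycle G φ (n + 1))) := by
  have hG := hT.isTree.connected
  have h := L.evolution hG hSt
  have hfin : ∀ x, (G.neighborSet x).Finite := fun x =>
    Set.finite_of_ncard_ne_zero (by rw [hT.regular]; omega)
  refine ⟨fun D hD hA hB hC hS hSD => ?_, fun hadj hS hC => ?_, fun hadj hS hC => ?_⟩
  · have hn : 1 ≤ n := by
      by_contra! hn
      obtain rfl : n = 0 := by omega
      exact (L.eq_A_or_B_zero hSt hab hD).elim hA hB
    refine ⟨⟨L.S n, ⟨h.isCl_S n, hS.symm, hSD.symm⟩, fun E ⟨hE, hED, hDE⟩ => ?_⟩,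
      h.hasCycle hD hS hC (h.canAdj_A hn hD hA hB hSD.symm) (h.canAdj_B hn hD hA hB hSD.symm)⟩
    by_contra hES
    exact h.not_isBranching hG hfin (fun x => (hT.regular x).le) hSt.finite
      ⟨hn, hD, hA, hB, hC, hS, hSD.symm, hE, hED.symm, hES, hDE⟩
  · obtain ⟨x, hx⟩ := h.nonempty (h.isCl_A (n + 1))
    exact h.hasCycle (h.isCl_A n) hS hC (CanAdj.of_sees hx (h.A_sees n x hx)).symm hadj.symm
  · obtain ⟨x, hx⟩ := h.nonempty (h.isCl_B (n + 1))
    exact h.hasCycle (h.isCl_B n) hS hC hadj.symm (CanAdj.of_sees hx (h.B_sees n x hx)).symm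

end Sturm
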